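/- arXiv:1307.0369 — 3 statements merged into one kernel-verified Lean document; each statement's English description precedes it below -/
import Mathlib

section
/- Let (R, m) be a commutative noetherian local ring and C a semidualizing R-module. If R is Gorenstein, then C ≅ R. Conversely, if C is a dualizing R-module (i.e., C additionally has finite injective dimension) and C ≅ R, then R is Gorenstein. -/
/-!
STATEMENT 7: Over a commutative noetherian local ring: if R is Gorenstein, then any
semidualizing module C satisfies C ≅ R; conversely, if C is dualizing (semidualizing
of finite injective dimension) and C ≅ R, then R is Gorenstein.
-/

open CategoryTheory

/-- `Ext^i_R(M, N)` for `R`-modules `M`, `N`. -/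
noncomputable def extMod (R : Type) [CommRing R] (M N : ModuleCat R) (i : ℕ) : ModuleCat R :=
  ((Ext R (ModuleCat R) i).obj (Opposite.op M)).obj N

/-- A finitely generated `R`-module `C` is semidualizing if the homothety map
`R → Hom_R(C, C)` is bijective and `Ext^i_R(C, C) = 0` for all `i ≥ 1`. -/
def IsSemidualizing (R : Type) [CommRing R] (C : Type) [AddCommGroup C] [Module R C] :
    Prop :=
  Module.Finite R C ∧
    Function.Bijective (LinearMap.lsmul R C) ∧
    ∀ i : ℕ, 1 ≤ i → Subsingleton (extMod R (ModuleCat.of R C) (ModuleCat.of R C) i)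

/-- An `R`-module `N` has finite injective dimension iff there is `n` such that
`Ext^i_R(M, N) = 0` for every module `M` and every `i > n`. -/
def HasFiniteInjectiveDimension (R : Type) [CommRing R] (N : ModuleCat R) : Prop :=
  ∃ n : ℕ, ∀ (M : ModuleCat R) (i : ℕ), n < i → Subsingleton (extMod R M N i)

/-- A commutative ring is Gorenstein if it has finite injective dimension over itself. -/
def IsGorenstein (R : Type) [CommRing R] : Prop :=
  HasFiniteInjectiveDimension R (ModuleCat.of R R)

lemma subsingleton_ext_of_subsingleton_extMod {R : Type} [CommRing R] {M N : ModuleCat R} {i : ℕ}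
    (hi : 1 ≤ i) (h : Subsingleton (extMod R M N i)) : Subsingleton (Abelian.Ext M N i) := by
  obtain ⟨p, rfl⟩ : ∃ p, i = p + 1 := ⟨i - 1, by omega⟩
  let P := projectiveResolution M
  have hz : Limits.IsZero ((P.complex.linearYonedaObj R N).homology (p + 1)) :=
    (ModuleCat.isZero_of_subsingleton (extMod R M N (p + 1))).of_iso (P.isoExt (p + 1) N).symm
  rw [← HomologicalComplex.exactAt_iff_isZero_homology,
    HomologicalComplex.exactAt_iff' _ p (p + 1) (p + 2) (by simp) (by simp),
    ShortComplex.moduleCat_exact_iff] at hz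
  refine subsingleton_of_forall_eq 0 fun α ↦ ?_
  obtain ⟨f, hf, rfl⟩ := P.extMk_surjective α (p + 2) rfl
  rw [P.extMk_eq_zero_iff f _ rfl hf p rfl]
  obtain ⟨g, hg⟩ := hz f hf
  exact ⟨g, hg⟩

lemma hasInjectiveDimensionLT_of_subsingleton_extMod {R : Type} [CommRing R] {N : ModuleCat R}
   {n : ℕ} (h : ∀ (M : ModuleCat R) (i : ℕ), n < i → Subsingleton (extMod R M N i)) :
    HasInjectiveDimensionLT N (n + 1) :=
  .mk fun i hi M e ↦
    (subsingleton_ext_of_subsingleton_extMod (by omega) (h M i hi)).elim e 0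

lemma subsingleton_extMod_of_iso {R : Type} [CommRing R] {N N' : ModuleCat R} (f : N ≅ N')
    (M : ModuleCat R) (i : ℕ)
   (h : Subsingleton (extMod R M N i)) : Subsingleton (extMod R M N' i) :=
  (show extMod R M N i ≅ extMod R M N' i from
    ((Ext R (ModuleCat R) i).obj (Opposite.op M)).mapIso f).toLinearEquiv.symm.toEquiv.subsingleton

/-- A regular element acts surjectively on an injective module. -/
lemma Module.Injective.exists_smul_eq {A E : Type} [CommRing A] [AddCommGroup E] [Module A E]
    [Module.Injective A E] {x : A} (hx : IsSMulRegular A x) (e : E) : ∃ e' : E, x • e' = e := by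
  obtain ⟨h, hh⟩ := Module.Injective.out (R := A) (Q := E) (LinearMap.lsmul A A x) hx
    (LinearMap.toSpanSingleton A E e)
  refine ⟨h 1, ?_⟩
  simpa [← map_smul] using hh 1

/-- The `x`-torsion of an injective module is injective over `A / xA`. -/
lemma Module.Injective.torsionBy {A E : Type} [CommRing A] [AddCommGroup E] [Module A E]
    [Module.Injective A E] (x : A) :
    Module.Injective (A ⧸ Ideal.span {x}) (Submodule.torsionBy A E x) := by
  rw [← Module.Baer.iff_injective]
  intro I g
  let π : A →ₐ[A] A ⧸ Ideal.span {x} := Ideal.Quotient.mkₐ A _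
  let J : Ideal A := I.comap π
  let q : J →ₗ[A] I := (π.toLinearMap.restrict (p := J) (q := I.restrictScalars A) fun a ha ↦ ha)
  obtain ⟨h, hh⟩ := Module.Injective.out (R := A) (Q := E) J.subtype J.injective_subtype
    ((Submodule.torsionBy A E x).subtype ∘ₗ g.restrictScalars A ∘ₗ q)
  have h1 : x • h 1 = 0 := by
    have hxJ : x ∈ J := by
      have : π x = 0 := Ideal.Quotient.eq_zero_iff_mem.mpr (Ideal.mem_span_singleton_self x)
      simp [J, this]
    have := hh ⟨x, hxJ⟩
    have h0 : q ⟨x, hxJ⟩ = 0 := Subtype.ext (Ideal.Quotient.eq_zero_iff_mem.mpr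
      (Ideal.mem_span_singleton_self x))
    rw [← map_smul]
    simpa [h0] using this
  refine ⟨LinearMap.toSpanSingleton _ _ ⟨h 1, h1⟩, fun y hy ↦ ?_⟩
  obtain ⟨a, rfl⟩ := Ideal.Quotient.mk_surjective y
  have := hh ⟨a, hy⟩
  apply Subtype.ext
  rw [LinearMap.toSpanSingleton_apply]
  change a • h 1 = _
  rw [← map_smul, smul_eq_mul, mul_one]
  exact this

/-- The map induced on `x`-torsion. -/
def torsionByMap {A : Type} [CommRing A] (x : A) {Q E : Type} [AddCommGroup Q] [Module A Q]
    [AddCommGroup E] [Module A E] (f : Q →ₗ[A] E) :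
    Submodule.torsionBy A Q x →ₗ[A ⧸ Ideal.span {x}] Submodule.torsionBy A E x :=
  LinearMap.extendScalarsOfSurjective Ideal.Quotient.mk_surjective
    (f.restrict fun q hq ↦ by
      rw [Submodule.mem_torsionBy_iff] at hq ⊢; rw [← map_smul, hq, map_zero])

section
variable {A : Type} [CommRing A] (x : A) {Q E T : Type} [AddCommGroup Q] [Module A Q]
    [AddCommGroup E] [Module A E] [AddCommGroup T] [Module A T] {f : Q →ₗ[A] E} {g : E →ₗ[A] T}

@[simp] lemma coe_torsionByMap (q : Submodule.torsionBy A Q x) :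
    (torsionByMap x f q : E) = f q := rfl

lemma torsionByMap_injective (hf : Function.Injective f) :
    Function.Injective (torsionByMap x f) := fun _ _ h ↦
  Subtype.ext (hf congr($h))

lemma torsionByMap_exact (hf : Function.Injective f) (hfg : Function.Exact f g) :
    Function.Exact (torsionByMap x f) (torsionByMap x g) := by
  intro e
  constructor
  · intro he
    obtain ⟨q, hq⟩ := (hfg e).mp congr(($he : T))
    refine ⟨⟨q, ?_⟩, Subtype.ext hq⟩
    rw [Submodule.mem_torsionBy_iff]
    apply hf
    rw [map_smul, hq, map_zero]
    exact Submodule.smul_coe_torsionBy _ _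
  · rintro ⟨q, rfl⟩
    exact Subtype.ext (hfg.apply_apply_eq_zero _)

lemma torsionByMap_surjective (hfg : Function.Exact f g) (hg : Function.Surjective g)
    (hQ : ∀ q : Q, ∃ q', x • q' = q) : Function.Surjective (torsionByMap x g) := by
  rintro ⟨t, ht⟩
  obtain ⟨e, rfl⟩ := hg t
  rw [Submodule.mem_torsionBy_iff, ← map_smul] at ht
  obtain ⟨q, hq⟩ := (hfg _).mp ht
  obtain ⟨q', rfl⟩ := hQ q
  refine ⟨⟨e - f q', ?_⟩, Subtype.ext ?_⟩
  · rw [Submodule.mem_torsionBy_iff, smul_sub, ← hq, map_smul, sub_self]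
  · simp [hfg.apply_apply_eq_zero]

/-- The connecting map of the snake lemma for multiplication by `x`, when `x` acts surjectively on
the
middle module `E`. -/
lemma exists_connecting_torsionBy {f : A →ₗ[A] E}
    (hf : Function.Injective f) (hfg : Function.Exact f g) (hg : Function.Surjective g)
    (hE : ∀ e : E, ∃ e', x • e' = e) :
    ∃ δ : Submodule.torsionBy A T x →ₗ[A ⧸ Ideal.span {x}] A ⧸ Ideal.span {x},
      Function.Surjective δ ∧ Function.Exact (torsionByMap x g) δ := by
  have lift : ∀ t : Submodule.torsionBy A T x, ∃ a, ∃ e, g e = t ∧ f a = x • e := by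
    rintro ⟨t, ht⟩
    obtain ⟨e, rfl⟩ := hg t
    rw [Submodule.mem_torsionBy_iff, ← map_smul] at ht
    obtain ⟨a, ha⟩ := (hfg _).mp ht
    exact ⟨a, e, rfl, ha⟩
  choose d hd using lift
  have uniq : ∀ (t : Submodule.torsionBy A T x) a e, g e = t → f a = x • e →
      Ideal.Quotient.mk (Ideal.span {x}) (d t) = Ideal.Quotient.mk _ a := by
    intro t a e h1 h2
    obtain ⟨e', h3, h4⟩ := hd t
    obtain ⟨b, hb⟩ := (hfg (e' - e)).mp (by rw [map_sub, h1, h3, sub_self])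
    rw [Ideal.Quotient.eq, Ideal.mem_span_singleton]
    refine ⟨b, hf ?_⟩
    rw [map_sub, h4, h2, ← smul_sub, ← hb, ← map_smul, smul_eq_mul]
  let δ₀ : Submodule.torsionBy A T x →ₗ[A] A ⧸ Ideal.span {x} :=
    { toFun t := Ideal.Quotient.mk _ (d t)
      map_add' s t := by
        obtain ⟨e, h1, h2⟩ := hd s
        obtain ⟨e', h3, h4⟩ := hd t
        rw [← map_add]
        exact uniq _ _ (e + e') (by simp [h1, h3]) (by simp [h2, h4])
      map_smul' a t := by
        obtain ⟨e, h1, h2⟩ := hd t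
        refine uniq _ (a • d t) (a • e) (by simp [h1]) ?_
        rw [map_smul, h2, smul_comm] }
  refine ⟨LinearMap.extendScalarsOfSurjective Ideal.Quotient.mk_surjective δ₀, ?_, ?_⟩
  · intro y
    obtain ⟨a, rfl⟩ := Ideal.Quotient.mk_surjective y
    obtain ⟨e, he⟩ := hE (f a)
    refine ⟨⟨g e, ?_⟩, uniq _ a e rfl he.symm⟩
    rw [Submodule.mem_torsionBy_iff, ← map_smul, he, hfg.apply_apply_eq_zero]
  · intro t
    change Ideal.Quotient.mk _ (d t) = 0 ↔ _
    rw [Ideal.Quotient.eq_zero_iff_mem, Ideal.mem_span_singleton]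
    constructor
    · rintro ⟨b, hb⟩
      obtain ⟨e, h1, h2⟩ := hd t
      refine ⟨⟨e - f b, ?_⟩, Subtype.ext ?_⟩
      · rw [Submodule.mem_torsionBy_iff, smul_sub, ← h2, hb, ← map_smul, smul_eq_mul, sub_self]
      · simp [hfg.apply_apply_eq_zero, h1]
    · rintro ⟨⟨e, he⟩, rfl⟩
      rw [Submodule.mem_torsionBy_iff] at he
      have := uniq (torsionByMap x g ⟨e, he⟩) 0 e rfl (by simp [he])
      rwa [map_zero, Ideal.Quotient.eq_zero_iff_mem, Ideal.mem_span_singleton] at this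

end

/-- Passing to the `x`-torsion of an `x`-divisible module does not raise injective dimension. -/
lemma hasInjectiveDimensionLT_torsionBy {A : Type} [CommRing A] {x : A} (hx : IsSMulRegular A x)
    (n : ℕ) : ∀ (Q : Type) [AddCommGroup Q] [Module A Q],
    (∀ q : Q, ∃ q', x • q' = q) → HasInjectiveDimensionLT (ModuleCat.of A Q) (n + 1) →
    HasInjectiveDimensionLT (ModuleCat.of (A ⧸ Ideal.span {x}) (Submodule.torsionBy A Q x))
      (n + 1) := by
  induction n with
  | zero =>
    intro Q _ _ _ hQ
    have : Module.Injective A Q := by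
      rwa [Module.injective_iff_injective_object, injective_iff_hasInjectiveDimensionLT_one]
    rw [zero_add, ← injective_iff_hasInjectiveDimensionLT_one, ←
      Module.injective_iff_injective_object]
    exact Module.Injective.torsionBy x
  | succ n ih =>
    intro Q _ _ hdiv hQ
    let ⟨E, _, f, _⟩ := EnoughInjectives.presentation (ModuleCat.of A Q)
    have injf : Function.Injective f.hom := (ModuleCat.mono_iff_injective f).mp ‹_›
    have : Module.Injective A E := Module.injective_module_of_injective_object A E
    let S : ShortComplex (ModuleCat A) :=
      ModuleCat.shortComplexOfCompEqZero _ _ f.hom.exact_map_mkQ_range.linearMap_comp_eq_zero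
    have hS : S.ShortExact := ModuleCat.shortComplex_shortExact S
      f.hom.exact_map_mkQ_range injf (Submodule.mkQ_surjective _)
    let S' : ShortComplex (ModuleCat (A ⧸ Ideal.span {x})) :=
      ModuleCat.shortComplexOfCompEqZero (torsionByMap x f.hom) (torsionByMap x f.hom.range.mkQ)
        (torsionByMap_exact x injf f.hom.exact_map_mkQ_range).linearMap_comp_eq_zero
    have hS' : S'.ShortExact := ModuleCat.shortComplex_shortExact S'
      (torsionByMap_exact x injf f.hom.exact_map_mkQ_range) (torsionByMap_injective x injf)
      (torsionByMap_surjective x f.hom.exact_map_mkQ_range (Submodule.mkQ_surjective _) hdiv)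
    have hE : ∀ e : E, ∃ e', x • e' = e := Module.Injective.exists_smul_eq hx
    have h3 := ih (E ⧸ f.hom.range) (fun q ↦ by
      obtain ⟨e, rfl⟩ := Submodule.mkQ_surjective _ q
      obtain ⟨e', rfl⟩ := hE e
      exact ⟨_, (map_smul _ x e').symm⟩) ((hS.hasInjectiveDimensionLT_X₃_iff n ‹_›).mpr hQ)
    have : Injective S'.X₂ := (Module.injective_iff_injective_object _ _).mp
      (Module.Injective.torsionBy x)
    exact (hS'.hasInjectiveDimensionLT_X₃_iff n this).mp h3

/-- The self-injective dimension drops modulo a regular element. -/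
lemma hasInjectiveDimensionLT_quotient_span_singleton {A : Type} [CommRing A] {x : A}
    (hx : IsSMulRegular A x) (n : ℕ)
    (h : HasInjectiveDimensionLT (ModuleCat.of A A) (n + 2)) :
    HasInjectiveDimensionLT (ModuleCat.of (A ⧸ Ideal.span {x}) (A ⧸ Ideal.span {x})) (n + 1) := by
  let ⟨E, _, f, _⟩ := EnoughInjectives.presentation (ModuleCat.of A A)
  have injf : Function.Injective f.hom := (ModuleCat.mono_iff_injective f).mp ‹_›
  have : Module.Injective A E := Module.injective_module_of_injective_object A E
  let S : ShortComplex (ModuleCat A) :=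
    ModuleCat.shortComplexOfCompEqZero _ _ f.hom.exact_map_mkQ_range.linearMap_comp_eq_zero
  have hS : S.ShortExact := ModuleCat.shortComplex_shortExact S
    f.hom.exact_map_mkQ_range injf (Submodule.mkQ_surjective _)
  have hE : ∀ e : E, ∃ e', x • e' = e := Module.Injective.exists_smul_eq hx
  have h3 := hasInjectiveDimensionLT_torsionBy hx n (E ⧸ f.hom.range) (fun q ↦ by
      obtain ⟨e, rfl⟩ := Submodule.mkQ_surjective _ q
      obtain ⟨e', rfl⟩ := hE e
      exact ⟨_, (map_smul _ x e').symm⟩) ((hS.hasInjectiveDimensionLT_X₃_iff n ‹_›).mpr h)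
  obtain ⟨δ, hδ, hex⟩ := exists_connecting_torsionBy x injf f.hom.exact_map_mkQ_range
    (Submodule.mkQ_surjective _) hE
  let S' : ShortComplex (ModuleCat (A ⧸ Ideal.span {x})) :=
    ModuleCat.shortComplexOfCompEqZero (torsionByMap x f.hom.range.mkQ) δ hex.linearMap_comp_eq_zero
  have inj' : Function.Injective (torsionByMap x f.hom.range.mkQ) := by
    rw [injective_iff_map_eq_zero]
    rintro ⟨e, he⟩ h0
    rw [Submodule.mem_torsionBy_iff] at he
    obtain ⟨a, rfl⟩ : e ∈ f.hom.range := (Submodule.Quotient.mk_eq_zero _).mp congr(($h0 : E ⧸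
      f.hom.range))
    rw [← map_smul] at he
    have : a = 0 := hx (by simpa using injf (he.trans (map_zero _).symm))
    subst this
    exact Subtype.ext (map_zero _)
  have hS' : S'.ShortExact := ModuleCat.shortComplex_shortExact S' hex inj' hδ
  have : Injective S'.X₁ := (Module.injective_iff_injective_object _ _).mp
    (Module.Injective.torsionBy x)
  exact hS'.hasInjectiveDimensionLT_X₃ (n + 1) h3 inferInstance

lemma subsingleton_ext_of_iso {A : Type} [CommRing A] {M M' : ModuleCat A} (e : M ≅ M')
    (N : ModuleCat A) (i : ℕ)
    (h : Subsingleton (Abelian.Ext M' N i)) : Subsingleton (Abelian.Ext M N i) := by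
  refine subsingleton_of_forall_eq 0 fun α ↦ ?_
  have : (Abelian.Ext.mk₀ e.hom).comp ((Abelian.Ext.mk₀ e.inv).comp α (zero_add i))
    (zero_add i) = α := by
    simp
  rw [← this, h.elim ((Abelian.Ext.mk₀ e.inv).comp α (zero_add i)) 0, Abelian.Ext.comp_zero]

open Pointwise in
lemma subsingleton_ext_of_isSMulRegular {A : Type} [CommRing A] [IsNoetherianRing A] [IsLocalRing A]
    {M N : ModuleCat A} [Module.Finite A M] [Module.Finite A N] {x : A} (hx : IsSMulRegular M x)
      (hxm : x ∈ IsLocalRing.maximalIdeal A)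
    (i : ℕ) (h : Subsingleton (Abelian.Ext (ModuleCat.of A (M ⧸ x • (⊤ : Submodule A M))) N
      (i + 1))) :
    Subsingleton (Abelian.Ext M N i) := by
  have hS := hx.smulShortComplex_shortExact
  have hsurj : ∀ α : Abelian.Ext M N i, ∃ β : Abelian.Ext M N i, x • β = α := by
    intro α
    obtain ⟨β, h1⟩ : ∃ β : Abelian.Ext M N i,
        (Abelian.Ext.mk₀ (x • 𝟙 M)).comp β (zero_add i) = α :=
      Abelian.Ext.contravariant_sequence_exact₁ hS N α (add_comm 1 i) (h.elim _ _)
    rw [Abelian.Ext.mk₀_smul, Abelian.Ext.smul_comp, Abelian.Ext.mk₀_id_comp] at h1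
    exact ⟨β, h1⟩
  refine (Submodule.subsingleton_iff A).mp (subsingleton_of_bot_eq_top (Eq.symm ?_))
  refine Submodule.eq_bot_of_le_smul_of_le_jacobson_bot (IsLocalRing.maximalIdeal A) ⊤
    Module.Finite.fg_top (fun α _ ↦ ?_) (IsLocalRing.maximalIdeal_le_jacobson _)
  obtain ⟨β, rfl⟩ := hsurj α
  exact Submodule.smul_mem_smul hxm trivial

/-- Over a noetherian local ring with nonzero socle, vanishing of `Ext^(i+1)(-, A)` on finite
modules
implies vanishing of `Ext^i(-, A)`. -/
lemma subsingleton_ext_self_of_succ_of_socle {A : Type} [CommRing A] [IsNoetherianRing A]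
    [IsLocalRing A] {s : A} (hs : s ≠ 0)
    (hms : ∀ x ∈ IsLocalRing.maximalIdeal A, x * s = 0) (i : ℕ) (hi : 1 ≤ i)
    (h : ∀ M : ModuleCat A, Module.Finite A M → Subsingleton
      (Abelian.Ext M (ModuleCat.of A A) (i + 1)))
    (M : Type) [AddCommGroup M] [Module A M] [Module.Finite A M] :
      Subsingleton (Abelian.Ext (ModuleCat.of A M) (ModuleCat.of A A) i) := by
  induction ‹Module.Finite A M› using IsNoetherianRing.induction_on_isQuotientEquivQuotientPrime A
    with
  | subsingleton N =>
    refine subsingleton_of_forall_eq 0 fun α ↦ ?_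
    rw [← α.mk₀_id_comp, (ModuleCat.isZero_of_subsingleton (ModuleCat.of A N)).eq_zero_of_src (𝟙 _),
      Abelian.Ext.mk₀_zero, Abelian.Ext.zero_comp]
  | quotient N p e =>
    refine subsingleton_ext_of_iso e.toModuleIso _ _ ?_
    by_cases hp : p.1 = IsLocalRing.maximalIdeal A
    · have hker : LinearMap.ker (LinearMap.toSpanSingleton A A s) = p.1 := by
        rw [hp]
        refine ((IsLocalRing.maximalIdeal.isMaximal A).eq_of_le ?_ fun x hx ↦ ?_).symm
        · rw [Ne, Ideal.eq_top_iff_one]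
          simpa using hs
        · simpa using hms x hx
      let f : (A ⧸ p.1) →ₗ[A] A := p.1.liftQ (LinearMap.toSpanSingleton A A s) hker.ge
      have hf : Function.Injective f := by
        rw [← LinearMap.ker_eq_bot]
        exact Submodule.ker_liftQ_eq_bot' _ _ hker.symm
      let S : ShortComplex (ModuleCat A) :=
        ModuleCat.shortComplexOfCompEqZero _ _ f.exact_map_mkQ_range.linearMap_comp_eq_zero
      have hS : S.ShortExact := ModuleCat.shortComplex_shortExact S
        f.exact_map_mkQ_range hf (Submodule.mkQ_surjective _)
      refine subsingleton_of_forall_eq 0 fun α ↦ ?_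
      obtain ⟨β, rfl⟩ := Abelian.Ext.contravariant_sequence_exact₁ hS _ α (add_comm 1 i)
        ((h (ModuleCat.of A (A ⧸ f.range)) inferInstance).elim _ _)
      obtain ⟨j, rfl⟩ : ∃ j, i = j + 1 := ⟨i - 1, by omega⟩
      have : Projective S.X₂ := (inferInstance : Projective (ModuleCat.of A A))
      rw [β.eq_zero_of_projective, Abelian.Ext.comp_zero]
    · obtain ⟨x, hx, hxp⟩ := Set.exists_of_ssubset ((IsLocalRing.le_maximalIdeal
      p.2.ne_top).lt_of_ne hp)
      refine subsingleton_ext_of_isSMulRegular (x := x) ?_ hx i (h _ inferInstance)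
      intro a b hab
      obtain ⟨a, rfl⟩ := Ideal.Quotient.mk_surjective a
      obtain ⟨b, rfl⟩ := Ideal.Quotient.mk_surjective b
      have h1 : Ideal.Quotient.mk p.1 (x * a) = Ideal.Quotient.mk p.1 (x * b) := hab
      rw [Ideal.Quotient.eq, ← mul_sub] at h1
      exact Ideal.Quotient.eq.mpr ((p.2.mem_or_mem h1).resolve_left hxp)
  | exact N₁ N₂ N₃ f g hf hg hfg h1 h3 =>
    let S : ShortComplex (ModuleCat A) :=
      ModuleCat.shortComplexOfCompEqZero f g hfg.linearMap_comp_eq_zero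
    have hS : S.ShortExact := ModuleCat.shortComplex_shortExact S hfg hf hg
    refine subsingleton_of_forall_eq 0 fun α ↦ ?_
    obtain ⟨β, rfl⟩ := Abelian.Ext.contravariant_sequence_exact₂ hS _ α (h1.elim _ _)
    rw [h3.elim β 0, Abelian.Ext.comp_zero]

/-- A noetherian local ring of finite self-injective dimension with nonzero socle satisfies
`Ext¹(M, A) = 0` for all finite `M`. -/
lemma subsingleton_ext_one_self_of_socle {A : Type} [CommRing A] [IsNoetherianRing A]
    [IsLocalRing A] {s : A} (hs : s ≠ 0)
    (hms : ∀ x ∈ IsLocalRing.maximalIdeal A, x * s = 0) {n : ℕ}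
    (h : HasInjectiveDimensionLT (ModuleCat.of A A) n)
    (M : Type) [AddCommGroup M] [Module A M] [Module.Finite A M] :
      Subsingleton (Abelian.Ext (ModuleCat.of A M) (ModuleCat.of A A) 1) := by
  suffices H : ∀ k i, 1 ≤ i → n ≤ i + k → ∀ M : ModuleCat A, Module.Finite A M →
      Subsingleton (Abelian.Ext M (ModuleCat.of A A) i) from
    H n 1 le_rfl (by omega) (ModuleCat.of A M) inferInstance
  intro k
  induction k with
  | zero => exact fun i _ hi M _ ↦ HasInjectiveDimensionLT.subsingleton _ n i hi M
  | succ k ih =>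
    exact fun i h1 hi M _ ↦ subsingleton_ext_self_of_succ_of_socle hs hms i h1
      (fun M hM ↦ ih (i + 1) (by omega) (by omega) M hM) M

lemma LinearMap.exists_extension_of_ext {A : Type} [CommRing A] {M P Q N : Type} [AddCommGroup M]
    [Module A M]
   [AddCommGroup P] [Module A P]  [AddCommGroup Q] [Module A Q] [AddCommGroup N] [Module A N]
   {f : M →ₗ[A] P} {g : P →ₗ[A] Q} (hf : Function.Injective f) (hg : Function.Surjective g)
   (hfg : Function.Exact f g)
   (h : Subsingleton (Abelian.Ext (ModuleCat.of A Q) (ModuleCat.of A N) 1)) (u : M →ₗ[A] N) :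
    ∃ v : P →ₗ[A] N, v ∘ₗ f = u := by
  let S : ShortComplex (ModuleCat A) :=
    ModuleCat.shortComplexOfCompEqZero f g hfg.linearMap_comp_eq_zero
  have hS : S.ShortExact := ModuleCat.shortComplex_shortExact S hfg hf hg
  obtain ⟨β, hβ⟩ := Abelian.Ext.contravariant_sequence_exact₁ hS (ModuleCat.of A N)
    (Abelian.Ext.mk₀ (ModuleCat.ofHom u)) (add_comm 1 0) (h.elim _ _)
  obtain ⟨v, rfl⟩ := Abelian.Ext.homEquiv₀.symm.surjective β
  refine ⟨v.hom, ?_⟩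
  rw [Abelian.Ext.homEquiv₀_symm_apply, Abelian.Ext.mk₀_comp_mk₀] at hβ
  exact congr(($(Abelian.Ext.homEquiv₀.symm.injective hβ)).hom)

lemma LinearMap.exists_lift_of_ext {A : Type} [CommRing A] {M P Q N : Type} [AddCommGroup M]
    [Module A M]
   [AddCommGroup P] [Module A P]  [AddCommGroup Q] [Module A Q] [AddCommGroup N] [Module A N]
   {f : M →ₗ[A] P} {g : P →ₗ[A] Q} (hf : Function.Injective f) (hg : Function.Surjective g)
   (hfg : Function.Exact f g)
   (h : Subsingleton (Abelian.Ext (ModuleCat.of A N) (ModuleCat.of A M) 1)) (u : N →ₗ[A] Q) :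
    ∃ v : N →ₗ[A] P, g ∘ₗ v = u := by
  let S : ShortComplex (ModuleCat A) :=
    ModuleCat.shortComplexOfCompEqZero f g hfg.linearMap_comp_eq_zero
  have hS : S.ShortExact := ModuleCat.shortComplex_shortExact S hfg hf hg
  obtain ⟨β, hβ⟩ := Abelian.Ext.covariant_sequence_exact₃ (ModuleCat.of A N) hS
    (Abelian.Ext.mk₀ (ModuleCat.ofHom u)) (add_comm 0 1) (h.elim _ _)
  obtain ⟨v, rfl⟩ := Abelian.Ext.homEquiv₀.symm.surjective β
  refine ⟨v.hom, ?_⟩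
  rw [Abelian.Ext.homEquiv₀_symm_apply, Abelian.Ext.mk₀_comp_mk₀] at hβ
  exact congr(($(Abelian.Ext.homEquiv₀.symm.injective hβ)).hom)

/-- The socle of a noetherian local ring of finite self-injective dimension is generated by any of
its
nonzero elements. -/
lemma exists_eq_mul_of_socle {A : Type} [CommRing A] [IsNoetherianRing A] [IsLocalRing A] {s t : A}
    (hs : s ≠ 0)
    (hms : ∀ x ∈ IsLocalRing.maximalIdeal A, x * s = 0)
    (hmt : ∀ x ∈ IsLocalRing.maximalIdeal A, x * t = 0) {n : ℕ}
    (h : HasInjectiveDimensionLT (ModuleCat.of A A) n) : ∃ b, t = b * s := by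
  let m := IsLocalRing.maximalIdeal A
  have hker : LinearMap.ker (LinearMap.toSpanSingleton A A s) = m := by
    refine ((IsLocalRing.maximalIdeal.isMaximal A).eq_of_le ?_ fun x hx ↦ ?_).symm
    · rw [Ne, Ideal.eq_top_iff_one]
      simpa using hs
    · simpa using hms x hx
  let f : (A ⧸ m) →ₗ[A] A := Submodule.liftQ m (LinearMap.toSpanSingleton A A s) hker.ge
  have hf : Function.Injective f := by
    rw [← LinearMap.ker_eq_bot]
    exact Submodule.ker_liftQ_eq_bot' _ _ hker.symm
  let g : (A ⧸ m) →ₗ[A] A := Submodule.liftQ m (LinearMap.toSpanSingleton A A t)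
    fun x hx ↦ by simpa using hmt x hx
  obtain ⟨v, hv⟩ := LinearMap.exists_extension_of_ext hf (Submodule.mkQ_surjective _)
    f.exact_map_mkQ_range
    (subsingleton_ext_one_self_of_socle hs hms h _) g
  refine ⟨v 1, ?_⟩
  have h1 : v (1 * s) = 1 * t := congr($hv (Ideal.Quotient.mk m 1))
  rw [← one_mul t, ← h1, one_mul, mul_comm, ← smul_eq_mul s, ← map_smul, smul_eq_mul, mul_one]

/-- If `Hom_R(C, N)` is a quotient ring `A` of `R` of finite self-injective dimension and `N` has a
nonzero element killed by the maximal ideal, then `C` is cyclic. -/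
lemma exists_span_singleton_eq_top_of_socle {R A C N : Type} [CommRing R] [IsLocalRing R]
    [CommRing A] [IsNoetherianRing A] [IsLocalRing A] [Algebra R A]
    [AddCommGroup C] [Module R C] [Module.Finite R C] [AddCommGroup N] [Module R N]
    (hRA : Function.Surjective (algebraMap R A)) (e : (C →ₗ[R] N) ≃ₗ[R] A) {n : ℕ}
    (hA : HasInjectiveDimensionLT (ModuleCat.of A A) n) {s : N} (hs : s ≠ 0)
    (hms : ∀ x ∈ IsLocalRing.maximalIdeal R, x • s = 0) :
    ∃ c : C, Submodule.span R {c} = ⊤ := by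
  let m := IsLocalRing.maximalIdeal R
  have hC : Nontrivial C := by
    by_contra hC
    rw [not_nontrivial_iff_subsingleton] at hC
    have := e.symm.toEquiv.subsingleton
    exact not_subsingleton A this
  have nakayama (P : Submodule R C) (hP : P ⊔ m • ⊤ = ⊤) : P = ⊤ :=
    top_le_iff.mp (Submodule.le_of_le_smul_of_le_jacobson_bot Module.Finite.fg_top
      (IsLocalRing.maximalIdeal_le_jacobson _) hP.ge)
  have hmC : m • (⊤ : Submodule R C) ≠ ⊤ := fun h ↦
    bot_ne_top (nakayama ⊥ (by rwa [bot_sup_eq]))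
  obtain ⟨c, -, hc⟩ := SetLike.exists_of_lt hmC.lt_top
  refine ⟨c, nakayama _ ?_⟩
  by_contra hne
  let V := C ⧸ (m • ⊤ : Submodule R C)
  let k := R ⧸ m
  let _ : Field k := Ideal.Quotient.field m
  let I : k →ₗ[R] N := m.liftQ (LinearMap.toSpanSingleton R N s) fun x hx ↦ by
    simpa using hms x hx
  have hker : LinearMap.ker (LinearMap.toSpanSingleton R N s) = m := by
    refine ((IsLocalRing.maximalIdeal.isMaximal R).eq_of_le ?_ fun x hx ↦ ?_).symm
    · rw [Ne, Ideal.eq_top_iff_one]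
      simpa using hs
    · simpa using hms x hx
  have hI : Function.Injective I := by
    rw [← LinearMap.ker_eq_bot]
    exact Submodule.ker_liftQ_eq_bot' _ _ hker.symm
  have hk (x : R) (hx : x ∈ m) (q : k) : x • q = 0 := by
    obtain ⟨r, rfl⟩ := Ideal.Quotient.mk_surjective q
    exact Ideal.Quotient.eq_zero_iff_mem.mpr (m.mul_mem_right r hx)
  let h (f : V →ₗ[k] k) : C →ₗ[R] N := I ∘ₗ f.restrictScalars R ∘ₗ Submodule.mkQ _
  have h_apply (f : V →ₗ[k] k) (y : C) : h f y = I (f (Submodule.Quotient.mk y)) := rfl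
  have h_ne {f : V →ₗ[k] k} (hf : f ≠ 0) : h f ≠ 0 := by
    contrapose! hf
    refine LinearMap.ext fun y ↦ ?_
    obtain ⟨y, rfl⟩ := Submodule.Quotient.mk_surjective _ y
    apply hI
    rw [← h_apply, hf]
    simp
  have h_smul (f : V →ₗ[k] k) (x : R) (hx : x ∈ m) : x • h f = 0 := by
    ext y
    rw [LinearMap.smul_apply, h_apply, ← map_smul, hk x hx, map_zero, LinearMap.zero_apply]
  have hlocal : IsLocalHom (algebraMap R A) := .of_surjective _ hRA
  have e_smul (f : V →ₗ[k] k) (x : A) (hx : x ∈ IsLocalRing.maximalIdeal A) : x * e (h f) = 0 := by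
    obtain ⟨x, rfl⟩ := hRA x
    rw [← Algebra.smul_def, ← map_smul, h_smul, map_zero]
    rw [IsLocalRing.mem_maximalIdeal, mem_nonunits_iff] at hx ⊢
    exact fun hu ↦ hx (hu.map _)
  obtain ⟨f₁, hf₁, -⟩ := Submodule.exists_le_ker_of_notMem (K := k) (p := (⊥ : Submodule k V))
    (v := Submodule.Quotient.mk c)
    (by rwa [Submodule.mem_bot, Submodule.Quotient.mk_eq_zero])
  obtain ⟨f₂, hf₂, hfc⟩ := Submodule.exists_le_ker_of_lt_top
    (Submodule.span k {(Submodule.Quotient.mk c : V)}) (by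
      rw [lt_top_iff_ne_top]
      contrapose! hne
      rw [eq_top_iff]
      intro y _
      have hy : (Submodule.Quotient.mk y : V) ∈
        Submodule.span k {(Submodule.Quotient.mk c : V)} := hne ▸ trivial
      obtain ⟨a, ha⟩ := Submodule.mem_span_singleton.mp hy
      obtain ⟨r, rfl⟩ := Ideal.Quotient.mk_surjective a
      have h1 : (Submodule.Quotient.mk (r • c) : V) = Submodule.Quotient.mk y := ha
      rw [Submodule.Quotient.eq] at h1
      rw [← sub_sub_cancel (r • c) y]
      exact sub_mem (Submodule.mem_sup_left (Submodule.smul_mem _ _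
        (Submodule.mem_span_singleton_self c))) (Submodule.mem_sup_right h1))
  have hfc : f₂ (Submodule.Quotient.mk c) = 0 := hfc (Submodule.mem_span_singleton_self _)
  have hf₁' : f₁ ≠ 0 := fun h0 ↦ hf₁ (by simp [h0])
  obtain ⟨b, hb⟩ := exists_eq_mul_of_socle (s := e (h f₁)) (t := e (h f₂))
    (by simpa using h_ne hf₁') (e_smul f₁) (e_smul f₂) hA
  obtain ⟨r, rfl⟩ := hRA b
  rw [← Algebra.smul_def, ← map_smul, e.injective.eq_iff] at hb
  by_cases hr : r ∈ m
  · exact h_ne hf₂ (hb.trans (h_smul f₁ r hr))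
  · have hu : IsUnit r := by simpa [m] using hr
    have h1 := congr($hb c)
    rw [LinearMap.smul_apply, h_apply, h_apply, hfc, map_zero, eq_comm, hu.smul_eq_zero] at h1
    exact hf₁ (hI (h1.trans (map_zero I).symm))

/-- A finite module over a noetherian local ring has a nonzero socle element or its maximal ideal
contains a regular element. -/
lemma exists_socle_or_exists_isSMulRegular (R N : Type) [CommRing R] [IsNoetherianRing R]
    [IsLocalRing R] [AddCommGroup N] [Module R N] [Module.Finite R N] :
    (∃ s : N, s ≠ 0 ∧ ∀ x ∈ IsLocalRing.maximalIdeal R, x • s = 0) ∨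
      ∃ x ∈ IsLocalRing.maximalIdeal R, IsSMulRegular N x := by
  by_cases h : Subsingleton ((R ⧸ IsLocalRing.maximalIdeal R) →ₗ[R] N)
  · rw [IsSMulRegular.subsingleton_linearMap_iff, Ideal.annihilator_quotient] at h
    exact .inr h
  · rw [not_subsingleton_iff_nontrivial] at h
    obtain ⟨f, hf⟩ := exists_ne (0 : (R ⧸ IsLocalRing.maximalIdeal R) →ₗ[R] N)
    refine .inl ⟨f 1, fun h0 ↦ hf ?_, fun x hx ↦ ?_⟩
    · refine LinearMap.ext fun y ↦ ?_
      obtain ⟨r, rfl⟩ := Ideal.Quotient.mk_surjective y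
      have : (Ideal.Quotient.mk _ r : R ⧸ IsLocalRing.maximalIdeal R) = r • 1 := by
        rw [Algebra.smul_def, mul_one]; rfl
      rw [this, map_smul, h0, smul_zero, LinearMap.zero_apply]
    · have : x • (1 : R ⧸ IsLocalRing.maximalIdeal R) = 0 := by
        rw [Algebra.smul_def, mul_one]
        exact Ideal.Quotient.eq_zero_iff_mem.mpr hx
      rw [← map_smul, this, map_zero]

section

variable {R A C N : Type} [CommRing R] [CommRing A] [Algebra R A] [AddCommGroup C] [Module R C]
  [AddCommGroup N] [Module R N] {x : R}

open Pointwise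

lemma subsingleton_ext_quotient_smul_top (hx : IsSMulRegular N x)
    (h : ∀ i, 1 ≤ i → Subsingleton (Abelian.Ext (ModuleCat.of R C) (ModuleCat.of R N) i))
    (i : ℕ) (hi : 1 ≤ i) : Subsingleton (Abelian.Ext (ModuleCat.of R C)
      (ModuleCat.of R (N ⧸ x • (⊤ : Submodule R N))) i) := by
  have hS := IsSMulRegular.smulShortComplex_shortExact (M := ModuleCat.of R N) hx
  refine subsingleton_of_forall_eq 0 fun α ↦ ?_
  obtain ⟨β, rfl⟩ := Abelian.Ext.covariant_sequence_exact₃ (ModuleCat.of R C) hS α rfl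
    ((h (i + 1) (by omega)).elim _ _)
  have hβ : β = 0 := (h i hi).elim _ _
  rw [hβ, Abelian.Ext.zero_comp]
  rfl

lemma isSMulRegular_algebraMap (e : (C →ₗ[R] N) ≃ₗ[R] A) (hx : IsSMulRegular N x) :
    IsSMulRegular A (algebraMap R A x) := by
  intro a b hab
  have h1 : x • a = x • b := by simpa [Algebra.smul_def] using hab
  obtain ⟨f, rfl⟩ := e.surjective a
  obtain ⟨g, rfl⟩ := e.surjective b
  rw [← map_smul, ← map_smul, e.injective.eq_iff] at h1
  exact congrArg e (LinearMap.ext fun c ↦ hx congr($h1 c))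

/-- If `Hom_R(C, N) ≃ A` and `Ext¹(C, N) = 0`, then `Hom_R(C, N / xN) ≃ A / xA` for `N`-regular
`x`. -/
lemma exists_linearEquiv_quotient_smul_top
    (e : (C →ₗ[R] N) ≃ₗ[R] A) (hx : IsSMulRegular N x)
    (h : Subsingleton (Abelian.Ext (ModuleCat.of R C) (ModuleCat.of R N) 1)) :
    Nonempty ((C →ₗ[R] N ⧸ x • (⊤ : Submodule R N)) ≃ₗ[R]
      A ⧸ Ideal.span {algebraMap R A x}) := by
  let q := (x • (⊤ : Submodule R N)).mkQ
  let F : A →ₗ[R] (C →ₗ[R] N ⧸ x • (⊤ : Submodule R N)) :=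
    (LinearMap.compRight R q) ∘ₗ e.symm.toLinearMap
  have hex := LinearMap.exact_lsmul_mkQ_smul_top N x
  have hF : Function.Surjective F := by
    intro u
    obtain ⟨v, hv⟩ := LinearMap.exists_lift_of_ext (f := LinearMap.lsmul R N x) hx
      (Submodule.mkQ_surjective _) hex h u
    refine ⟨e v, ?_⟩
    rw [← hv]
    simp [F, q]
  have hker : LinearMap.ker F = (Ideal.span {algebraMap R A x}).restrictScalars R := by
    ext a
    rw [LinearMap.mem_ker, Submodule.restrictScalars_mem, Ideal.mem_span_singleton]
    constructor
    · intro ha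
      have h1 (c : C) : ∃ y, x • y = e.symm a c := (hex _).mp congr($ha c)
      choose d hd using h1
      let g : C →ₗ[R] N :=
        { toFun := d
          map_add' b c := hx <| by
            change x • d (b + c) = x • (d b + d c)
            rw [smul_add, hd, hd, hd, map_add]
          map_smul' r c := hx <| by
            change x • d (r • c) = x • r • d c
            rw [smul_comm, hd, hd, map_smul] }
      refine ⟨e g, ?_⟩
      rw [← Algebra.smul_def, ← map_smul, ← e.symm_apply_eq]
      exact LinearMap.ext fun c ↦ (hd c).symm
    · rintro ⟨b, rfl⟩
      rw [← Algebra.smul_def]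
      refine LinearMap.ext fun c ↦ ?_
      exact (hex _).mpr ⟨e.symm b c, by simp⟩
  let G : A →ₗ[R] A ⧸ Ideal.span {algebraMap R A x} := (Ideal.Quotient.mkₐ R _).toLinearMap
  have hG : LinearMap.ker G = LinearMap.ker F := by
    ext a
    rw [hker]
    exact Ideal.Quotient.eq_zero_iff_mem
  exact ⟨(F.quotKerEquivOfSurjective hF).symm ≪≫ₗ Submodule.quotEquivOfEq _ _ hG.symm ≪≫ₗ
    G.quotKerEquivOfSurjective Ideal.Quotient.mk_surjective⟩

/-- If `Hom_R(C, N)` is a quotient ring `A` of `R` of finite self-injective dimension and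
`Ext^i_R(C, N) = 0` for all `i ≥ 1`, then `C` is cyclic. -/
lemma exists_span_singleton_eq_top_of_ext [IsNoetherianRing R] [IsLocalRing R]
    [Module.Finite R C] (n : ℕ) :
    ∀ (A : Type) [CommRing A] [Algebra R A] [Nontrivial A] (N : Type) [AddCommGroup N]
      [Module R N] [Module.Finite R N], Function.Surjective (algebraMap R A) →
      ((C →ₗ[R] N) ≃ₗ[R] A) →
      (∀ i, 1 ≤ i → Subsingleton (Abelian.Ext (ModuleCat.of R C) (ModuleCat.of R N) i)) →
      HasInjectiveDimensionLT (ModuleCat.of A A) (n + 1) →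
      ∃ c : C, Submodule.span R {c} = ⊤ := by
  induction n with
  | zero =>
    intro A _ _ _ N _ _ _ hRA e hN hA
    have : IsLocalRing A := .of_surjective' _ hRA
    have : IsNoetherianRing A := isNoetherianRing_of_surjective _ _ _ hRA
    have : IsLocalHom (algebraMap R A) := .of_surjective _ hRA
    obtain ⟨s, hs, hms⟩ | ⟨x, hxm, hx⟩ := exists_socle_or_exists_isSMulRegular R N
    · exact exists_span_singleton_eq_top_of_socle hRA e hA hs hms
    · have hxA := isSMulRegular_algebraMap e hx
      have : Module.Injective A A := by
        rwa [Module.injective_iff_injective_object, injective_iff_hasInjectiveDimensionLT_one]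
      obtain ⟨y, hy⟩ := Module.Injective.exists_smul_eq hxA (1 : A)
      have : IsUnit (algebraMap R A x) := .of_mul_eq_one _ hy
      exact absurd (isUnit_of_map_unit _ _ this) hxm
  | succ n ih =>
    intro A _ _ _ N _ _ _ hRA e hN hA
    have : IsLocalRing A := .of_surjective' _ hRA
    have : IsNoetherianRing A := isNoetherianRing_of_surjective _ _ _ hRA
    have : IsLocalHom (algebraMap R A) := .of_surjective _ hRA
    obtain ⟨s, hs, hms⟩ | ⟨x, hxm, hx⟩ := exists_socle_or_exists_isSMulRegular R N
    · exact exists_span_singleton_eq_top_of_socle hRA e hA hs hms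
    · have hxA := isSMulRegular_algebraMap e hx
      obtain ⟨e'⟩ := exists_linearEquiv_quotient_smul_top e hx (hN 1 le_rfl)
      have : Nontrivial (A ⧸ Ideal.span {algebraMap R A x}) := by
        rw [Ideal.Quotient.nontrivial_iff, Ne, Ideal.span_singleton_eq_top]
        exact fun h ↦ hxm (isUnit_of_map_unit _ _ h)
      exact ih (A ⧸ Ideal.span {algebraMap R A x}) (N ⧸ x • (⊤ : Submodule R N))
        (Ideal.Quotient.mk_surjective.comp hRA) e' (subsingleton_ext_quotient_smul_top hx hN)
        (hasInjectiveDimensionLT_quotient_span_singleton hxA n hA)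

end

/-- If `R` is Gorenstein then every semidualizing module is free of rank one; conversely,
for a dualizing module `C`, `C ≅ R` forces `R` to be Gorenstein. -/
theorem semidualizing_of_gorenstein_and_converse
    (R : Type) [CommRing R] [IsNoetherianRing R] [IsLocalRing R]
    (C : Type) [AddCommGroup C] [Module R C]
    (hC : IsSemidualizing R C) :
    (IsGorenstein R → Nonempty (C ≃ₗ[R] R)) ∧
      (HasFiniteInjectiveDimension R (ModuleCat.of R C) → Nonempty (C ≃ₗ[R] R) →
        IsGorenstein R) := by
  refine ⟨fun ⟨n, hn⟩ ↦ ?_, fun ⟨n, hn⟩ ⟨e⟩ ↦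
    ⟨n, fun M i hi ↦ subsingleton_extMod_of_iso e.toModuleIso M i (hn M i hi)⟩⟩
  obtain ⟨_, hbij, hext⟩ := hC
  obtain ⟨c, hc⟩ := exists_span_singleton_eq_top_of_ext n R C Function.surjective_id
    (LinearEquiv.ofBijective (LinearMap.lsmul R C) hbij).symm
    (fun i hi ↦ subsingleton_ext_of_subsingleton_extMod hi (hext i hi))
    (hasInjectiveDimensionLT_of_subsingleton_extMod hn)
  have hsurj : Function.Surjective (LinearMap.toSpanSingleton R C c) := fun y ↦
    Submodule.mem_span_singleton.mp (hc ▸ Submodule.mem_top)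
  refine ⟨(LinearEquiv.ofBijective (LinearMap.toSpanSingleton R C c) ⟨?_, hsurj⟩).symm⟩
  rw [injective_iff_map_eq_zero]
  intro r hr
  apply hbij.1
  refine LinearMap.ext fun y ↦ ?_
  obtain ⟨a, rfl⟩ := hsurj y
  rw [LinearMap.toSpanSingleton_apply] at hr
  simp [hr]
end

section
/- Let (R, m, k) be a Cohen–Macaulay commutative noetherian local ring that admits a semidualizing module C which is neither free (C ≇ R) nor dualizing. Then the sequence of Bass numbers (μ^i_R)_{i≥0} of R is unbounded. -/
/-!
STATEMENT 15: A Cohen–Macaulay commutative noetherian local ring admitting a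
semidualizing module that is neither free nor dualizing has unbounded Bass numbers.
-/

open CategoryTheory

/-- A noetherian local ring is Cohen–Macaulay when `depth R = dim R`; since always
`depth R ≤ dim R`, this is equivalent to: the Krull dimension is some `d : ℕ` and
`Ext^i_R(k, R) = 0` for `i < d`, where `k` is the residue field. -/
def IsCohenMacaulayLocal (R : Type) [CommRing R] [IsLocalRing R] : Prop :=
  ∃ d : ℕ, ringKrullDim R = d ∧
    ∀ i : ℕ, i < d →
      Subsingleton
        (extMod R (ModuleCat.of R (IsLocalRing.ResidueField R)) (ModuleCat.of R R) i)

/-- The length of an `R`-module, encoded as the Krull dimension of its lattice of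
submodules. -/
noncomputable def moduleLength (R : Type) [CommRing R] (M : Type) [AddCommGroup M]
    [Module R M] : WithBot ℕ∞ :=
  Order.krullDim (Submodule R M)

/-- The `i`-th Bass number `μ^i_R = dim_k Ext^i_R(k, R)` of a local ring `(R, m, k)`,
computed as the length of the `R`-module `Ext^i_R(k, R)` (a `k`-vector space). -/
noncomputable def bassNumber (R : Type) [CommRing R] [IsLocalRing R] (i : ℕ) :
    WithBot ℕ∞ :=
  moduleLength R
    (extMod R (ModuleCat.of R (IsLocalRing.ResidueField R)) (ModuleCat.of R R) i)

namespace CategoryTheory.ProjectiveResolution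

/-- The classes in `Ext` of the `n`-cocycles of `Hom(P, Y)`, as a linear map. -/
noncomputable def extMkLinear {R : Type} [CommRing R] {X : ModuleCat.{0} R}
    (P : ProjectiveResolution X) (Y : ModuleCat.{0} R) (n : ℕ) :
    LinearMap.ker ((P.complex.linearYonedaObj R Y).sc' n (n + 1) (n + 2)).g.hom →ₗ[R]
      Abelian.Ext X Y (n + 1) where
  toFun f := P.extMk f.1 (n + 2) rfl f.2
  map_add' f g := (P.add_extMk f.1 g.1 (n + 2) rfl f.2 g.2).symm
  map_smul' r f := by
    rw [RingHom.id_apply, Abelian.Ext.smul_eq_comp_mk₀]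
    refine Eq.trans ?_ (P.extMk_comp_mk₀ f.1 (n + 2) rfl f.2 (r • 𝟙 Y)).symm
    congr 1

lemma nonempty_homology_linearYonedaObj_linearEquiv {R : Type} [CommRing R] {X : ModuleCat.{0} R}
    (P : ProjectiveResolution X) (Y : ModuleCat.{0} R) (n : ℕ) :
    Nonempty ((P.complex.linearYonedaObj R Y).homology (n + 1) ≃ₗ[R] Abelian.Ext X Y (n + 1)) := by
  have hsurj : Function.Surjective (P.extMkLinear Y n) := fun α ↦ by
    obtain ⟨f, hf, h⟩ := P.extMk_surjective α (n + 2) rfl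
    exact ⟨⟨f, hf⟩, h⟩
  have hker : LinearMap.range
      ((P.complex.linearYonedaObj R Y).sc' n (n + 1) (n + 2)).moduleCatToCycles =
      LinearMap.ker (P.extMkLinear Y n) := by
    ext f
    refine Iff.trans ?_ (P.extMk_eq_zero_iff f.1 (n + 2) rfl f.2 n rfl).symm
    exact exists_congr fun g ↦ Subtype.ext_iff
  exact ⟨(((P.complex.linearYonedaObj R Y).homologyIsoSc' n (n + 1) (n + 2) (by simp) (by simp)) ≪≫
    ShortComplex.moduleCatHomologyIso _).toLinearEquiv ≪≫ₗ
    (Submodule.quotEquivOfEq _ _ hker ≪≫ₗ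
      (P.extMkLinear Y n).quotKerEquivOfSurjective hsurj)⟩

end CategoryTheory.ProjectiveResolution

lemma nonempty_extMod_succ_linearEquiv (R : Type) [CommRing R] (M N : ModuleCat.{0} R) (n : ℕ) :
    Nonempty (extMod R M N (n + 1) ≃ₗ[R] Abelian.Ext M N (n + 1)) := by
  let P := projectiveResolution M
  obtain ⟨e⟩ := P.nonempty_homology_linearYonedaObj_linearEquiv N n
  exact ⟨(P.isoExt (R := R) (n + 1) N).toLinearEquiv ≪≫ₗ e⟩

universe u

section

variable {R : Type u} [CommRing R]

lemma Module.Injective.linearMap_of_projective (F J : Type u) [AddCommGroup F] [Module R F]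
    [Module.Projective R F] [AddCommGroup J] [Module R J] [Module.Injective R J] :
    Module.Injective R (F →ₗ[R] J) where
  out X Y _ _ _ _ f hf g := by
    have hsurj : Function.Surjective (LinearMap.lcomp R J f) := fun h ↦ by
      obtain ⟨h', hh'⟩ := Module.Injective.out f hf h
      exact ⟨h', LinearMap.ext hh'⟩
    obtain ⟨h, hh⟩ := Module.projective_lifting_property _ g.flip hsurj
    refine ⟨h.flip, fun x ↦ LinearMap.ext fun y ↦ ?_⟩
    simpa using LinearMap.congr_fun (LinearMap.congr_fun hh y) x

/-- The image of a short exact sequence `N → J → Q` under `Hom(Z, -)`. -/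
lemma shortExact_linearMap_compRight {Z N J Q : Type u} [AddCommGroup Z] [Module R Z]
    [AddCommGroup N] [Module R N] [AddCommGroup J] [Module R J] [AddCommGroup Q] [Module R Q]
    {f : N →ₗ[R] J} {g : J →ₗ[R] Q}
    (hf : Function.Injective f) (hfg : Function.Exact f g)
    (hs : Function.Surjective (LinearMap.compRight R g : (Z →ₗ[R] J) →ₗ[R] (Z →ₗ[R] Q))) :
    (ModuleCat.shortComplexOfCompEqZero
      (LinearMap.compRight R f : (Z →ₗ[R] N) →ₗ[R] (Z →ₗ[R] J))
      (LinearMap.compRight R g : (Z →ₗ[R] J) →ₗ[R] (Z →ₗ[R] Q)) (by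
        ext h z; exact hfg.apply_apply_eq_zero (h z))).ShortExact := by
  refine ModuleCat.shortComplex_shortExact _ (fun h ↦ ⟨fun hh ↦ ?_, ?_⟩) (fun h₁ h₂ hh ↦ ?_) hs
  · have hr : LinearMap.range h ≤ LinearMap.range f := by
      rintro _ ⟨z, rfl⟩
      exact (hfg (h z)).mp (LinearMap.congr_fun hh z)
    refine ⟨(LinearEquiv.ofInjective f hf).symm.toLinearMap ∘ₗ
      h.codRestrict (LinearMap.range f) (fun z ↦ hr ⟨z, rfl⟩), LinearMap.ext fun z ↦ ?_⟩
    exact congrArg Subtype.val ((LinearEquiv.ofInjective f hf).apply_symm_apply ⟨h z, _⟩)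
  · rintro ⟨h', rfl⟩
    ext z
    exact hfg.apply_apply_eq_zero (h' z)
  · exact LinearMap.ext fun z ↦ hf (LinearMap.congr_fun hh z)

lemma surjective_compRight_of_ext_one_eq_zero {S : ShortComplex (ModuleCat.{u} R)}
    (hS : S.ShortExact) (Z : ModuleCat.{u} R) (h : ∀ x : Abelian.Ext Z S.X₁ 1, x = 0) :
    Function.Surjective (LinearMap.compRight R S.g.hom : (Z →ₗ[R] S.X₂) →ₗ[R] (Z →ₗ[R] S.X₃)) := by
  intro φ
  obtain ⟨x, hx⟩ := Abelian.Ext.covariant_sequence_exact₃ Z hS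
    (Abelian.Ext.mk₀ (ModuleCat.ofHom φ)) (zero_add 1) (h _)
  obtain ⟨ψ, rfl⟩ := Abelian.Ext.homEquiv₀.symm.surjective x
  rw [Abelian.Ext.homEquiv₀_symm_apply, Abelian.Ext.mk₀_comp_mk₀] at hx
  refine ⟨ψ.hom, ?_⟩
  have := Abelian.Ext.homEquiv₀.symm.injective hx
  exact congrArg ModuleCat.Hom.hom this

lemma surjective_lcomp_of_ext_one_eq_zero {S : ShortComplex (ModuleCat.{u} R)}
    (hS : S.ShortExact) (C : ModuleCat.{u} R) (h : ∀ x : Abelian.Ext S.X₃ C 1, x = 0) :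
    Function.Surjective (LinearMap.lcomp R C S.f.hom) := by
  intro φ
  obtain ⟨x, hx⟩ := Abelian.Ext.contravariant_sequence_exact₁ hS C
    (Abelian.Ext.mk₀ (ModuleCat.ofHom φ)) (zero_add 1) (h _)
  obtain ⟨ψ, rfl⟩ := Abelian.Ext.homEquiv₀.symm.surjective x
  rw [Abelian.Ext.homEquiv₀_symm_apply, Abelian.Ext.mk₀_comp_mk₀] at hx
  refine ⟨ψ.hom, ?_⟩
  have := Abelian.Ext.homEquiv₀.symm.injective hx
  exact congrArg ModuleCat.Hom.hom this

/-- If `ι : Z → F` maps into `I F`, `F` is projective, and `Ext^i(Z, N) = 0` for `i ≥ 1`,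
then `Hom(F, N) → Hom(Z, N)` induces zero on `Ext^i(K, -)` for any `K` killed by `I`. -/
lemma ext_comp_lcomp_eq_zero {F Z : Type u} [AddCommGroup F] [Module R F] [Module.Projective R F]
    [AddCommGroup Z] [Module R Z] (ι : Z →ₗ[R] F) (I : Ideal R)
    (hι : LinearMap.range ι ≤ I • ⊤) (K : ModuleCat.{u} R) (hK : ∀ a ∈ I, ∀ x : K, a • x = 0)
    (i : ℕ) (N : ModuleCat.{u} R)
    (hN : ∀ i, ∀ x : Abelian.Ext (ModuleCat.of R Z) N (i + 1), x = 0)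
    (e : Abelian.Ext K (ModuleCat.of R (F →ₗ[R] N)) i) :
    e.comp (Abelian.Ext.mk₀ (ModuleCat.ofHom (LinearMap.lcomp R N ι))) (add_zero i) = 0 := by
  induction i generalizing N with
  | zero =>
    obtain ⟨h, rfl⟩ := Abelian.Ext.homEquiv₀.symm.surjective e
    rw [Abelian.Ext.homEquiv₀_symm_apply, Abelian.Ext.mk₀_comp_mk₀]
    refine (congrArg Abelian.Ext.mk₀ ?_).trans (Abelian.Ext.mk₀_zero _ _)
    ext x z
    change h.hom x (ι z) = 0
    refine Submodule.smul_induction_on (p := fun y ↦ h.hom x y = 0) (hι ⟨z, rfl⟩)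
      (fun a ha y _ ↦ ?_) (fun y y' hy hy' ↦ by rw [map_add, hy, hy', add_zero])
    rw [map_smul, ← LinearMap.smul_apply, ← map_smul, hK a ha, map_zero, LinearMap.zero_apply]
  | succ n ih =>
    obtain ⟨J, hJ, f, hf⟩ := EnoughInjectives.presentation N
    have hf' : Function.Injective f.hom := (ModuleCat.mono_iff_injective f).mp hf
    have hJ' : Module.Injective R J := Module.injective_module_of_injective_object R J
    have hex := f.hom.exact_map_mkQ_range
    have hS := ModuleCat.shortComplex_shortExact
      (ModuleCat.shortComplexOfCompEqZero _ _ hex.linearMap_comp_eq_zero) hex hf'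
      (Submodule.mkQ_surjective _)
    have hSF := shortExact_linearMap_compRight (Z := F) hf' hex
      (fun φ ↦ Module.projective_lifting_property _ φ (Submodule.mkQ_surjective _))
    have hSZ := shortExact_linearMap_compRight (Z := Z) hf' hex
      (surjective_compRight_of_ext_one_eq_zero hS (ModuleCat.of R Z) (hN 0))
    have hinj : Injective (ModuleCat.of R (F →ₗ[R] J)) :=
      Module.injective_object_of_injective_module R _
        (inj := Module.Injective.linearMap_of_projective F J)
    obtain ⟨e', rfl⟩ := Abelian.Ext.covariant_sequence_exact₁ K hSF e
      (Abelian.Ext.eq_zero_of_injective (I := ModuleCat.of R (F →ₗ[R] J)) _) rfl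
    have hnat := ShortComplex.ShortExact.extClass_naturality hSF hSZ
      { τ₁ := ModuleCat.ofHom (LinearMap.lcomp R N ι)
        τ₂ := ModuleCat.ofHom (LinearMap.lcomp R J ι)
        τ₃ := ModuleCat.ofHom (LinearMap.lcomp R _ ι)
        comm₁₂ := rfl
        comm₂₃ := rfl }
    have hQ : ∀ i, ∀ x : Abelian.Ext (ModuleCat.of R Z)
        (ModuleCat.of R (J ⧸ LinearMap.range f.hom)) (i + 1), x = 0 := fun i x ↦ by
      obtain ⟨y, rfl⟩ := Abelian.Ext.covariant_sequence_exact₃ _ hS x rfl (hN (i + 1) _)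
      rw [Abelian.Ext.eq_zero_of_injective (I := J) y, Abelian.Ext.zero_comp]
    have := ih (ModuleCat.of R (J ⧸ LinearMap.range f.hom)) hQ e'
    rw [Abelian.Ext.comp_assoc _ _ _ _ (add_zero 1) (by lia)]
    refine (congrArg (fun y ↦ e'.comp y rfl) hnat).trans ?_
    rw [← Abelian.Ext.comp_assoc _ _ _ (add_zero n) _ (by lia)]
    exact (congrArg (fun y ↦ Abelian.Ext.comp y hSZ.extClass rfl) this).trans
      (Abelian.Ext.zero_comp _ _ _ _ _)

open IsLocalRing in
/-- A finitely generated module over a local ring has a minimal free cover. -/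
lemma IsLocalRing.exists_minimal_free_cover [IsLocalRing R] (Z : Type u) [AddCommGroup Z]
    [Module R Z] [Module.Finite R Z] :
    ∃ (n : ℕ) (f : (Fin n → R) →ₗ[R] Z), Function.Surjective f ∧
      LinearMap.ker f ≤ maximalIdeal R • ⊤ := by
  let k := ResidueField R
  let b := Module.finBasis k (TensorProduct R k Z)
  choose z hz using fun i ↦ TensorProduct.mk_surjective R Z k Ideal.Quotient.mk_surjective (b i)
  refine ⟨_, Fintype.linearCombination R z, ?_, fun v hv ↦ ?_⟩
  · rw [← LinearMap.range_eq_top, Fintype.range_linearCombination]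
    exact IsLocalRing.span_eq_top_of_tmul_eq_basis z b hz
  · have h : ∑ i, residue R (v i) • b i = 0 := by
      have := congrArg (TensorProduct.mk R k Z 1) hv
      rw [map_zero, Fintype.linearCombination_apply, map_sum] at this
      rw [← this]
      refine Finset.sum_congr rfl fun i _ ↦ ?_
      rw [map_smul, hz]
      exact (algebraMap_smul k (v i) (b i))
    have hv' := Fintype.linearIndependent_iff.mp b.linearIndependent _ h
    rw [pi_eq_sum_univ' v]
    refine Submodule.sum_mem _ fun i _ ↦ Submodule.smul_mem_smul ?_ trivial
    exact (residue_eq_zero_iff _).mp (hv' i)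

/-- Additivity of length along `0 → Ext^n(K, X₃) → Ext^{n+1}(K, X₁) → Ext^{n+1}(K, X₂) → 0`, for a
short exact sequence inducing zero maps `Ext(K, X₂) → Ext(K, X₃)` in every degree. -/
lemma length_ext_eq_add {S : ShortComplex (ModuleCat.{u} R)} (hS : S.ShortExact)
    (K : ModuleCat.{u} R) (h : ∀ n, ∀ x : Abelian.Ext K S.X₂ n,
      x.comp (Abelian.Ext.mk₀ S.g) (add_zero n) = 0) (n : ℕ) :
    Module.length R (Abelian.Ext K S.X₁ (n + 1)) =
      Module.length R (Abelian.Ext K S.X₃ n) + Module.length R (Abelian.Ext K S.X₂ (n + 1)) := by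
  refine Module.length_eq_add_of_exact (hS.extClass.postcompOfLinear R K rfl)
    ((Abelian.Ext.mk₀ S.f).postcompOfLinear R K (add_zero (n + 1))) ?_ ?_ ?_
  · rw [injective_iff_map_eq_zero]
    intro x hx
    obtain ⟨y, rfl⟩ := Abelian.Ext.covariant_sequence_exact₃ K hS x rfl hx
    exact h n y
  · exact fun x ↦ Abelian.Ext.covariant_sequence_exact₂ K hS x (h _ x)
  · refine fun x ↦ ⟨fun hx ↦ Abelian.Ext.covariant_sequence_exact₁ K hS x hx rfl, ?_⟩
    rintro ⟨y, rfl⟩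
    simp [Abelian.Ext.comp_assoc _ _ _ rfl (add_zero 1) _]

lemma length_ext_le {S : ShortComplex (ModuleCat.{u} R)} (hS : S.ShortExact)
    (K : ModuleCat.{u} R) (n : ℕ) (h : ∀ x : Abelian.Ext K S.X₂ n,
      x.comp (Abelian.Ext.mk₀ S.g) (add_zero n) = 0) :
    Module.length R (Abelian.Ext K S.X₂ n) ≤ Module.length R (Abelian.Ext K S.X₁ n) :=
  Module.length_le_of_surjective ((Abelian.Ext.mk₀ S.f).postcompOfLinear R K (add_zero n))
    fun x ↦ Abelian.Ext.covariant_sequence_exact₂ K hS x (h x)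

lemma nontrivial_ext_linearMap (K C : ModuleCat.{u} R) {ι : Type} [Nonempty ι] (n : ℕ)
    [Nontrivial (Abelian.Ext K C n)] :
    Nontrivial (Abelian.Ext K (ModuleCat.of R ((ι → R) →ₗ[R] C)) n) := by
  classical
  obtain ⟨j⟩ := ‹Nonempty ι›
  let s : C ⟶ ModuleCat.of R ((ι → R) →ₗ[R] C) := ModuleCat.ofHom
    (LinearMap.lcomp R C (LinearMap.proj j) ∘ₗ (LinearMap.ringLmapEquivSelf R R C).symm.toLinearMap)
  let p : ModuleCat.of R ((ι → R) →ₗ[R] C) ⟶ C :=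
    ModuleCat.ofHom (LinearMap.applyₗ (Pi.single j (1 : R)))
  have hsp : s ≫ p = 𝟙 C := by
    ext c
    simp [s, p]
  have hinv : Function.LeftInverse
      (fun x : Abelian.Ext K (ModuleCat.of R ((ι → R) →ₗ[R] C)) n ↦
        x.comp (Abelian.Ext.mk₀ p) (add_zero n))
      (fun x : Abelian.Ext K C n ↦ x.comp (Abelian.Ext.mk₀ s) (add_zero n)) := fun x ↦ by
    simp [hsp]
  exact hinv.injective.nontrivial

open IsLocalRing in
/-- The first syzygy in a minimal cover of a non-free module `Z` with `Ext^1(Z, C) = 0`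
is not free. -/
lemma not_free_ker_of_ext_one_eq_zero [IsLocalRing R] {F Z : Type u} [AddCommGroup F] [Module R F]
    [Module.Free R F] [AddCommGroup Z] [Module R Z] (C : ModuleCat.{u} R) [Module.Finite R C]
    [Nontrivial C] (f : F →ₗ[R] Z) (hf : Function.Surjective f)
    (hm : LinearMap.ker f ≤ maximalIdeal R • ⊤) (hZ : ¬ Module.Free R Z)
    (h : ∀ x : Abelian.Ext (ModuleCat.of R Z) C 1, x = 0) :
    ¬ Module.Free R (LinearMap.ker f) := by
  intro hfree
  rcases isEmpty_or_nonempty (Module.Free.ChooseBasisIndex R (LinearMap.ker f)) with he | ⟨⟨i⟩⟩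
  · have hbot : LinearMap.ker f = ⊥ := by
      have : Subsingleton (LinearMap.ker f) :=
        (Module.Free.chooseBasis R (LinearMap.ker f)).repr.toEquiv.subsingleton
      exact Submodule.eq_bot_of_subsingleton
    exact hZ (Module.Free.of_equiv
      (LinearEquiv.ofBijective f ⟨LinearMap.ker_eq_bot.mp hbot, hf⟩))
  · let b := Module.Free.chooseBasis R (LinearMap.ker f)
    have hsurj := surjective_lcomp_of_ext_one_eq_zero (LinearMap.shortExact_shortComplexKer hf) C h
    have htop : (⊤ : Submodule R C) ≤ maximalIdeal R • ⊤ := fun c _ ↦ by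
      obtain ⟨G, hG⟩ := hsurj ((b.coord i).smulRight c)
      have hGc : G (b i) = c := by
        simpa using LinearMap.congr_fun hG (b i)
      rw [← hGc]
      have := Submodule.mem_map_of_mem (f := G) (hm (b i).2)
      rw [Submodule.map_smul''] at this
      exact Submodule.smul_mono le_rfl le_top this
    have := Submodule.eq_bot_of_le_smul_of_le_jacobson_bot _ _ Module.Finite.fg_top htop
      (maximalIdeal_le_jacobson _)
    exact bot_ne_top this.symm

open IsLocalRing in
/-- If `Z` is not free, `Ext^i(Z, C) = 0` for `i ≥ 1` and `K` is killed by the maximal ideal, then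
`Ext^n(K, Hom(Z, C))` has length at least the number of `i ≤ n` with `Ext^i(K, C) ≠ 0`. -/
lemma card_le_length_ext [IsLocalRing R] [IsNoetherianRing R] (C : ModuleCat.{u} R)
    [Module.Finite R C] [Nontrivial C] (K : ModuleCat.{u} R)
    (hK : ∀ a ∈ maximalIdeal R, ∀ x : K, a • x = 0) (s : Set ℕ)
    (hs : ∀ i ∈ s, Nontrivial (Abelian.Ext K C i)) [DecidablePred (· ∈ s)]
    (n : ℕ) (Z : Type u) [AddCommGroup Z] [Module R Z] [Module.Finite R Z]
    (hZ : ¬ Module.Free R Z) (hext : ∀ i, ∀ x : Abelian.Ext (ModuleCat.of R Z) C (i + 1), x = 0) :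
    (((Finset.range (n + 1)).filter (· ∈ s)).card : ℕ∞) ≤
      Module.length R (Abelian.Ext K (ModuleCat.of R (Z →ₗ[R] C)) n) := by
  induction n using Nat.strong_induction_on generalizing Z with
  | _ n ih =>
  obtain ⟨m, f, hf, hker⟩ := IsLocalRing.exists_minimal_free_cover (R := R) Z
  have hm : Nonempty (Fin m) := by
    by_contra h
    rw [not_nonempty_iff] at h
    have := hf.subsingleton
    exact hZ inferInstance
  have hS := LinearMap.shortExact_shortComplexKer hf
  have hsyz : ∀ i, ∀ x : Abelian.Ext (ModuleCat.of R (LinearMap.ker f)) C (i + 1), x = 0 :=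
    fun i x ↦ by
      obtain ⟨y, rfl⟩ := Abelian.Ext.contravariant_sequence_exact₁ hS C x (add_comm 1 (i + 1))
        (hext (i + 1) _)
      have : Projective (ModuleCat.of R (Fin m → R)) := inferInstance
      rw [Abelian.Ext.eq_zero_of_projective (P := ModuleCat.of R (Fin m → R)) y,
        Abelian.Ext.comp_zero]
  have hT : (ModuleCat.shortComplexOfCompEqZero (LinearMap.lcomp R C f)
      (LinearMap.lcomp R C (LinearMap.ker f).subtype) (by ext φ x; simp)).ShortExact :=
    ModuleCat.shortComplex_shortExact _
      (LinearMap.exact_lcomp_of_exact_of_surjective _ f.exact_subtype_ker_map hf)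
      (LinearMap.lcomp_injective_of_surjective f hf)
      (surjective_lcomp_of_ext_one_eq_zero hS C (hext 0))
  have hzero := fun i ↦ ext_comp_lcomp_eq_zero (LinearMap.ker f).subtype (maximalIdeal R)
    (by rwa [Submodule.range_subtype]) K hK i C hsyz
  have hone : ((if n ∈ s then 1 else 0 : ℕ) : ℕ∞) ≤
      Module.length R (Abelian.Ext K (ModuleCat.of R ((Fin m → R) →ₗ[R] C)) n) := by
    split_ifs with hn
    · have := hs n hn
      have := nontrivial_ext_linearMap K C (ι := Fin m) n
      exact Order.one_le_iff_pos.mpr Module.length_pos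
    · exact zero_le
  rw [Finset.range_add_one, Finset.filter_insert, apply_ite Finset.card,
    Finset.card_insert_of_notMem (by simp)]
  cases n with
  | zero =>
    exact le_trans (by simp) (hone.trans (length_ext_le hT K 0 (hzero 0)))
  | succ n =>
    refine le_trans ?_ ((add_le_add (ih n n.lt_succ_self (LinearMap.ker f)
      (not_free_ker_of_ext_one_eq_zero C f hf hker hZ (hext 0)) hsyz) hone).trans
        (length_ext_eq_add hT K hzero n).ge)
    split_ifs <;> simp

lemma factor_comp_mapQ_lsmul (I J : Ideal R) (a : R)
    (hJ : J ≤ Submodule.comap (LinearMap.lsmul R R a) I) :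
    Submodule.factor (le_sup_left : I ≤ I ⊔ Ideal.span {a}) ∘ₗ
      Submodule.mapQ J I (LinearMap.lsmul R R a) hJ = 0 := by
  refine LinearMap.ext fun y ↦ ?_
  obtain ⟨y, rfl⟩ := Submodule.mkQ_surjective _ y
  exact (Submodule.Quotient.mk_eq_zero _).mpr
    (Ideal.mem_sup_right (Ideal.mul_mem_right _ _ (Ideal.mem_span_singleton_self a)))

/-- The sequence `0 → R/(I : a) → R/I → R/(I + aR) → 0`. -/
lemma shortExact_quotient_comap (I J : Ideal R) (a : R)
    (hJ : J = Submodule.comap (LinearMap.lsmul R R a) I) :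
    (ModuleCat.shortComplexOfCompEqZero (Submodule.mapQ J I (LinearMap.lsmul R R a) hJ.le)
      (Submodule.factor (le_sup_left : I ≤ I ⊔ Ideal.span {a}))
      (factor_comp_mapQ_lsmul I J a hJ.le)).ShortExact := by
  refine ModuleCat.shortComplex_shortExact _ ?_ ?_
    (Submodule.factor_surjective (le_sup_left : I ≤ I ⊔ Ideal.span {a}))
  · intro y
    obtain ⟨y, rfl⟩ := Submodule.mkQ_surjective _ y
    constructor
    · intro hy
      have hy' : y ∈ I ⊔ Ideal.span {a} := (Submodule.Quotient.mk_eq_zero _).mp hy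
      obtain ⟨i, hi, z, hz, rfl⟩ := Submodule.mem_sup.mp hy'
      obtain ⟨r, rfl⟩ := Ideal.mem_span_singleton'.mp hz
      refine ⟨Submodule.mkQ _ r, (Submodule.Quotient.eq _).mpr ?_⟩
      have : a * r - (i + r * a) = -i := by ring
      exact this ▸ neg_mem hi
    · rintro ⟨z, hz⟩
      rw [← hz]
      exact LinearMap.congr_fun (factor_comp_mapQ_lsmul I J a hJ.le) z
  · refine (injective_iff_map_eq_zero _).mpr fun y hy ↦ ?_
    obtain ⟨y, rfl⟩ := Submodule.mkQ_surjective _ y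
    refine (Submodule.Quotient.mk_eq_zero _).mpr ?_
    rw [hJ]
    exact (Submodule.Quotient.mk_eq_zero I).mp hy

open IsLocalRing in
/-- If `Ext^j(k, C) = 0` for all `j ≥ n`, then `Ext^j(R/I, C) = 0` for all `j ≥ n`. -/
lemma ext_quotient_eq_zero_of_ext_residueField_eq_zero [IsLocalRing R] [IsNoetherianRing R]
    (C : ModuleCat.{u} R) [Module.Finite R C] (n : ℕ)
    (h : ∀ j, n ≤ j → ∀ x : Abelian.Ext (ModuleCat.of R (ResidueField R)) C j, x = 0)
    (I : Ideal R) : ∀ j, n ≤ j → ∀ x : Abelian.Ext (ModuleCat.of R (R ⧸ I)) C j, x = 0 := by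
  induction I using IsNoetherian.induction with
  | hgt I ih =>
  intro j hj y
  by_cases hI : I = ⊤
  · have hzero : 𝟙 (ModuleCat.of R (R ⧸ I)) = 0 := by
      have : Subsingleton (R ⧸ I) := Ideal.Quotient.subsingleton_iff.mpr hI
      exact ModuleCat.hom_ext (LinearMap.ext fun x ↦ Subsingleton.elim _ _)
    rw [← Abelian.Ext.mk₀_id_comp y, hzero, Abelian.Ext.mk₀_zero, Abelian.Ext.zero_comp]
  by_cases hle : maximalIdeal R ≤ I
  · obtain rfl := (maximalIdeal.isMaximal R).eq_of_le hI hle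
    exact h j hj y
  obtain ⟨a, ham, haI⟩ := SetLike.not_le_iff_exists.mp hle
  have hlt : I < I ⊔ Ideal.span {a} := left_lt_sup.mpr fun hh ↦
    haI (hh (Ideal.mem_span_singleton_self a))
  have hIJ : I ≤ Submodule.comap (LinearMap.lsmul R R a) I := fun r hr ↦ Ideal.mul_mem_left I a hr
  rcases hIJ.eq_or_lt with heq | hlt'
  · have hS := shortExact_quotient_comap I I a heq
    have htop : (⊤ : Submodule R (Abelian.Ext (ModuleCat.of R (R ⧸ I)) C j)) ≤
        maximalIdeal R • ⊤ := fun x _ ↦ by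
      obtain ⟨x', rfl⟩ := Abelian.Ext.contravariant_sequence_exact₁ hS C x (add_comm 1 j)
        (ih _ hlt (j + 1) (by lia) _)
      have hf : ModuleCat.ofHom (Submodule.mapQ I I (LinearMap.lsmul R R a) heq.le) =
          a • 𝟙 (ModuleCat.of R (R ⧸ I)) := by
        ext; rfl
      have : (Abelian.Ext.mk₀ (a • 𝟙 (ModuleCat.of R (R ⧸ I)))).comp x' (zero_add j) = a • x' := by
        rw [Abelian.Ext.mk₀_smul, Abelian.Ext.smul_comp, Abelian.Ext.mk₀_id_comp]
      rw [← hf] at this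
      refine this.symm ▸ Submodule.smul_mem_smul ham trivial
    have := Submodule.eq_bot_of_le_smul_of_le_jacobson_bot _ _ Module.Finite.fg_top htop
      (maximalIdeal_le_jacobson _)
    exact (Submodule.mem_bot R).mp (this ▸ Submodule.mem_top)
  · have hS := shortExact_quotient_comap I _ a rfl
    obtain ⟨x, rfl⟩ := Abelian.Ext.contravariant_sequence_exact₂ hS C y (ih _ hlt' j hj _)
    rw [ih _ hlt j hj x, Abelian.Ext.comp_zero]

lemma hasInjectiveDimensionLE_of_ext_quotient_eq_zero (n : ℕ) (N : ModuleCat.{u} R)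
    (h : ∀ I : Ideal R, ∀ x : Abelian.Ext (ModuleCat.of R (R ⧸ I)) N (n + 1), x = 0) :
    HasInjectiveDimensionLE N n := by
  induction n generalizing N with
  | zero =>
    have hN : Module.Baer R N := Module.Baer.iff_surjective.mpr fun I ↦
      surjective_lcomp_of_ext_one_eq_zero (ModuleCat.shortComplex_shortExact
        (ModuleCat.shortComplexOfCompEqZero I.subtype I.mkQ
          (LinearMap.exact_subtype_mkQ I).linearMap_comp_eq_zero)
        (LinearMap.exact_subtype_mkQ I) I.injective_subtype I.mkQ_surjective) N (h I)
    have := Module.injective_object_of_injective_module R N (inj := hN.injective)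
    exact (injective_iff_hasInjectiveDimensionLT_one).mp this
  | succ n ih =>
    obtain ⟨J, hJ, f, hf⟩ := EnoughInjectives.presentation N
    have hex := f.hom.exact_map_mkQ_range
    have hS := ModuleCat.shortComplex_shortExact
      (ModuleCat.shortComplexOfCompEqZero _ _ hex.linearMap_comp_eq_zero) hex
      ((ModuleCat.mono_iff_injective f).mp hf) (Submodule.mkQ_surjective _)
    refine (hS.hasInjectiveDimensionLT_X₃_iff n hJ).mp (ih _ fun I x ↦ ?_)
    obtain ⟨y, rfl⟩ := Abelian.Ext.covariant_sequence_exact₃ _ hS x rfl (h I _)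
    rw [Abelian.Ext.eq_zero_of_injective (I := J) y, Abelian.Ext.zero_comp]

lemma length_ext_le_of_iso (K : ModuleCat.{u} R) {M N : ModuleCat.{u} R} (e : M ≅ N) (n : ℕ) :
    Module.length R (Abelian.Ext K M n) ≤ Module.length R (Abelian.Ext K N n) := by
  refine Module.length_le_of_injective
    ((Abelian.Ext.mk₀ e.hom).postcompOfLinear R K (add_zero n))
    (Function.LeftInverse.injective
      (g := fun x ↦ x.comp (Abelian.Ext.mk₀ e.inv) (add_zero n)) fun x ↦ ?_)
  simp

lemma not_free_of_bijective_lsmul [Nontrivial R] {C : Type u} [AddCommGroup C] [Module R C]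
    [Module.Finite R C] (h : Function.Bijective (LinearMap.lsmul R C))
    (hnot : IsEmpty (C ≃ₗ[R] R)) : ¬ Module.Free R C := by
  intro hfree
  have h1 := (LinearEquiv.ofBijective _ h).finrank_eq
  rw [Module.finrank_self, show Module.finrank R (Module.End R C) = _ from
    Module.finrank_linearMap R R C C] at h1
  have h2 : Module.finrank R C = 1 := Nat.eq_one_of_mul_eq_one_right h1.symm
  exact hnot.false (LinearEquiv.ofFinrankEq _ _ (h2.trans (Module.finrank_self R).symm))

end

/-- Over a noetherian local ring, the groups `Ext^i(k, C)` are nonzero for infinitely many `i`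
when `C` is a finitely generated module of infinite injective dimension. -/
lemma infinite_setOf_nontrivial_ext_residueField {R : Type} [CommRing R] [IsNoetherianRing R]
    [IsLocalRing R] (C : ModuleCat.{0} R) [Module.Finite R C]
    (hC : ¬ HasFiniteInjectiveDimension R C) :
    {i | Nontrivial
      (Abelian.Ext (ModuleCat.of R (IsLocalRing.ResidueField R)) C i)}.Infinite := by
  intro hfin
  obtain ⟨n, hn⟩ := hfin.bddAbove
  have hk : ∀ j, n + 1 ≤ j →
      ∀ x : Abelian.Ext (ModuleCat.of R (IsLocalRing.ResidueField R)) C j, x = 0 := by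
    intro j hj x
    by_contra hx
    exact absurd (hn (show j ∈ _ from ⟨x, 0, hx⟩)) (by lia)
  have hdim : HasInjectiveDimensionLE C n :=
    hasInjectiveDimensionLE_of_ext_quotient_eq_zero n C fun I ↦
      ext_quotient_eq_zero_of_ext_residueField_eq_zero C (n + 1) hk I (n + 1) le_rfl
  refine hC ⟨n, fun M i hi ↦ ?_⟩
  obtain ⟨i, rfl⟩ := Nat.exists_eq_add_one_of_ne_zero (Nat.ne_zero_of_lt hi)
  obtain ⟨e⟩ := nonempty_extMod_succ_linearEquiv R M C i
  have := HasInjectiveDimensionLT.subsingleton C (n + 1) (i + 1) hi M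
  exact e.toEquiv.subsingleton

/-- If a Cohen–Macaulay noetherian local ring `R` has a semidualizing module that is
neither free (`C ≇ R`) nor dualizing, then the sequence of Bass numbers of `R` is
unbounded. -/
theorem bass_numbers_unbounded_of_nontrivial_semidualizing
    (R : Type) [CommRing R] [IsNoetherianRing R] [IsLocalRing R]
    (hCM : IsCohenMacaulayLocal R)
    (C : Type) [AddCommGroup C] [Module R C]
    (hC : IsSemidualizing R C)
    (hnotfree : IsEmpty (C ≃ₗ[R] R))
    (hnotdualizing : ¬ HasFiniteInjectiveDimension R (ModuleCat.of R C)) :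
    ∀ B : ℕ, ∃ i : ℕ, (B : WithBot ℕ∞) < bassNumber R i := by
  classical
  intro B
  obtain ⟨hfin, hbij, hext⟩ := hC
  let K := ModuleCat.of R (IsLocalRing.ResidueField R)
  have : Nontrivial C := by
    by_contra h
    rw [not_nontrivial_iff_subsingleton] at h
    exact one_ne_zero (hbij.injective (Subsingleton.elim (LinearMap.lsmul R C 1) 0 |>.trans
      (map_zero _).symm))
  let s := {i | Nontrivial (Abelian.Ext K (ModuleCat.of R C) i)}
  obtain ⟨t, hts, ht⟩ :=
    (infinite_setOf_nontrivial_ext_residueField _ hnotdualizing).exists_subset_card_eq (B + 1)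
  obtain ⟨n, hn⟩ := t.bddAbove
  have hCext : ∀ i, ∀ x : Abelian.Ext (ModuleCat.of R C) (ModuleCat.of R C) (i + 1), x = 0 := by
    intro i x
    obtain ⟨e⟩ := nonempty_extMod_succ_linearEquiv R (ModuleCat.of R C) (ModuleCat.of R C) i
    have := hext (i + 1) (by lia)
    have := e.symm.toEquiv.subsingleton
    exact Subsingleton.elim _ _
  have hK : ∀ a ∈ IsLocalRing.maximalIdeal R, ∀ x : K, a • x = 0 := fun a ha x ↦
    (Algebra.smul_def a (x : IsLocalRing.ResidueField R)).trans
      (by rw [IsLocalRing.ResidueField.algebraMap_eq, (IsLocalRing.residue_eq_zero_iff a).mpr ha,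
        zero_mul])
  have hle := card_le_length_ext (ModuleCat.of R C) K hK s (fun _ hi ↦ hi) (n + 1) C
    (not_free_of_bijective_lsmul hbij hnotfree) hCext
  have hcard : B + 1 ≤ ((Finset.range (n + 1 + 1)).filter (· ∈ s)).card := by
    rw [← ht]
    refine Finset.card_le_card fun i hi ↦ Finset.mem_filter.mpr ⟨?_, hts hi⟩
    have := hn hi
    exact Finset.mem_range.mpr (by lia)
  obtain ⟨e⟩ := nonempty_extMod_succ_linearEquiv R K (ModuleCat.of R R) n
  have hiso := length_ext_le_of_iso K (LinearEquiv.ofBijective _ hbij).symm.toModuleIso (n + 1)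
  refine ⟨n + 1, ?_⟩
  rw [bassNumber, moduleLength, ← Module.coe_length, e.length_eq]
  have hlt : (B : ℕ∞) < ((B + 1 : ℕ) : ℕ∞) := Nat.cast_lt.mpr B.lt_succ_self
  exact WithBot.coe_lt_coe.mpr
    (hlt.trans_le ((Nat.cast_le.mpr hcard).trans (hle.trans hiso)))
end

section
/- A commutative noetherian local ring R admits a dualizing module if and only if R is Cohen–Macaulay and a homomorphic image of a Gorenstein local ring. -/
/-!
STATEMENT 18: A commutative noetherian local ring admits a dualizing module iff it
is Cohen–Macaulay and a homomorphic image of a Gorenstein local ring.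
-/

open CategoryTheory

section Comparison

variable {R : Type} [CommRing R]

lemma subsingleton_extMod_iff_exists_lift {M N : ModuleCat.{0} R} (P : ProjectiveResolution M)
    (i : ℕ) : Subsingleton (extMod R M N i) ↔
      ∀ f : P.complex.X i ⟶ N, P.complex.d (i + 1) i ≫ f = 0 →
        ∃ g : P.complex.X ((ComplexShape.up ℕ).prev i) ⟶ N, P.complex.d i _ ≫ g = f := by
  have e := (P.isoExt (R := R) i N)
  rw [extMod, e.toLinearEquiv.toEquiv.subsingleton_congr, ← ModuleCat.isZero_iff_subsingleton,
    ← HomologicalComplex.exactAt_iff_isZero_homology,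
    HomologicalComplex.exactAt_iff' _ _ i (i + 1) rfl (by simp),
    ShortComplex.moduleCat_exact_iff]
  rfl

lemma subsingleton_extMod_iff (M N : ModuleCat.{0} R) (i : ℕ) :
    Subsingleton (extMod R M N i) ↔ Subsingleton (Abelian.Ext M N i) := by
  let P := projectiveResolution M
  rw [subsingleton_extMod_iff_exists_lift P]
  cases i with
  | zero =>
    rw [Abelian.Ext.addEquiv₀.toEquiv.subsingleton_congr]
    have hd : P.complex.d 0 ((ComplexShape.up ℕ).prev 0) = 0 :=
      P.complex.shape _ _ (by simp)
    change _ ↔ Subsingleton (((ChainComplex.single₀ (ModuleCat R)).obj M).X 0 ⟶ N)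
    constructor
    · intro h
      refine subsingleton_of_forall_eq 0 fun f => ?_
      obtain ⟨g, hg⟩ := h (P.π.f 0 ≫ f) (by
        rw [← Category.assoc, P.complex_d_comp_π_f_zero, Limits.zero_comp])
      rw [hd, Limits.zero_comp] at hg
      rw [← cancel_epi (P.π.f 0), ← hg, Limits.comp_zero]
    · intro h f hf
      obtain ⟨l, hl⟩ := P.exact₀.desc' f hf
      exact ⟨0, by rw [← hl, h.elim l 0]; exact Limits.comp_zero.trans Limits.comp_zero.symm⟩
  | succ n =>
    have hp : (ComplexShape.up ℕ).prev (n + 1) = n := by simp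
    rw [hp]
    constructor
    · intro h
      refine subsingleton_of_forall_eq 0 fun x => ?_
      obtain ⟨f, hf, rfl⟩ := P.extMk_surjective x (n + 2) rfl
      rw [P.extMk_eq_zero_iff f _ rfl hf n rfl]
      exact h f hf
    · intro h f hf
      rw [← P.extMk_eq_zero_iff f _ rfl hf n rfl]
      exact Subsingleton.elim _ _

end Comparison

namespace CategoryTheory.ShortComplex.ShortExact

open Abelian

universe w v u

variable {C : Type u} [Category.{v} C] [Abelian C] [HasExt.{w} C] {S : ShortComplex C}

lemma subsingleton_ext_left₂ (hS : S.ShortExact) (Y : C) (n : ℕ) (h₁ : Subsingleton (Ext S.X₁ Y n))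
    (h₃ : Subsingleton (Ext S.X₃ Y n)) : Subsingleton (Ext S.X₂ Y n) := by
  refine subsingleton_of_forall_eq 0 fun x => ?_
  obtain ⟨y, rfl⟩ := Ext.contravariant_sequence_exact₂ hS Y x (Subsingleton.elim _ _)
  simp [Subsingleton.elim y 0]

lemma subsingleton_ext_left₁ (hS : S.ShortExact) (Y : C) (n : ℕ) (h₂ : Subsingleton (Ext S.X₂ Y n))
    (h₃ : Subsingleton (Ext S.X₃ Y (n + 1))) : Subsingleton (Ext S.X₁ Y n) := by
  refine subsingleton_of_forall_eq 0 fun x => ?_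
  obtain ⟨y, rfl⟩ := Ext.contravariant_sequence_exact₁ hS Y x (add_comm 1 n)
    (Subsingleton.elim _ _)
  simp [Subsingleton.elim y 0]

lemma subsingleton_ext_left₃ (hS : S.ShortExact) (Y : C) (n : ℕ) (h₁ : Subsingleton (Ext S.X₁ Y n))
    (h₂ : Subsingleton (Ext S.X₂ Y (n + 1))) : Subsingleton (Ext S.X₃ Y (n + 1)) := by
  refine subsingleton_of_forall_eq 0 fun x => ?_
  obtain ⟨y, rfl⟩ := Ext.contravariant_sequence_exact₃ hS Y x (Subsingleton.elim _ _)
    (add_comm 1 n)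
  simp [Subsingleton.elim y 0]

lemma subsingleton_ext_right₁ (hS : S.ShortExact) (X : C) (n : ℕ) (h₃ : Subsingleton (Ext X S.X₃ n))
    (h₂ : Subsingleton (Ext X S.X₂ (n + 1))) : Subsingleton (Ext X S.X₁ (n + 1)) := by
  refine subsingleton_of_forall_eq 0 fun x => ?_
  obtain ⟨y, rfl⟩ := Ext.covariant_sequence_exact₁ X hS x (Subsingleton.elim _ _) rfl
  simp [Subsingleton.elim y 0]

lemma subsingleton_ext_right₃ (hS : S.ShortExact) (X : C) (n : ℕ) (h₂ : Subsingleton (Ext X S.X₂ n))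
    (h₁ : Subsingleton (Ext X S.X₁ (n + 1))) : Subsingleton (Ext X S.X₃ n) := by
  refine subsingleton_of_forall_eq 0 fun x => ?_
  obtain ⟨y, rfl⟩ := Ext.covariant_sequence_exact₃ X hS x rfl (Subsingleton.elim _ _)
  simp [Subsingleton.elim y 0]

end CategoryTheory.ShortComplex.ShortExact

section Support

open Pointwise

universe u

variable {R : Type u} [CommRing R]

lemma Module.support_subset_union_of_exact {M N P : Type*} [AddCommGroup M] [Module R M]
    [AddCommGroup N] [Module R N] [AddCommGroup P] [Module R P] {f : M →ₗ[R] N} {g : N →ₗ[R] P}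
    (h : Function.Exact f g) :
    Module.support R N ⊆ Module.support R M ∪ Module.support R P := by
  intro p hp
  by_contra hc
  rw [Set.mem_union, not_or, Module.notMem_support_iff', Module.notMem_support_iff'] at hc
  obtain ⟨n, hn⟩ := Module.mem_support_iff'.mp hp
  obtain ⟨r, hr, hrn⟩ := hc.2 (g n)
  obtain ⟨m, hm⟩ := (h (r • n)).mp (by rw [map_smul, hrn])
  obtain ⟨s, hs, hsm⟩ := hc.1 m
  refine hn (s * r) (p.asIdeal.primeCompl.mul_mem hs hr) ?_
  rw [mul_smul, ← hm, ← map_smul, hsm, map_zero]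

/-- An isomorphism in the first variable induces a linear equivalence on `Ext`. -/
noncomputable def ModuleCat.extLinearEquivOfIso {M M' : ModuleCat.{u} R} (e : M ≅ M')
    (N : ModuleCat.{u} R) (i : ℕ) : Abelian.Ext M' N i ≃ₗ[R] Abelian.Ext M N i :=
  LinearEquiv.ofLinearMap
    ((Abelian.Ext.mk₀ e.hom).precompOfLinear R N (zero_add i))
    ((Abelian.Ext.mk₀ e.inv).precompOfLinear R N (zero_add i))
    (by ext x; simp) (by ext x; simp)

/-- An isomorphism in the second variable induces a bijection on `Ext`. -/
noncomputable def ModuleCat.extEquivOfIsoRight (M : ModuleCat.{u} R) {N N' : ModuleCat.{u} R}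
    (e : N ≅ N') (i : ℕ) : Abelian.Ext M N i ≃ Abelian.Ext M N' i where
  toFun x := x.comp (Abelian.Ext.mk₀ e.hom) (add_zero i)
  invFun x := x.comp (Abelian.Ext.mk₀ e.inv) (add_zero i)
  left_inv x := by simp
  right_inv x := by simp

lemma CategoryTheory.ShortComplex.ShortExact.exact_precompOfLinear
    {S : ShortComplex (ModuleCat.{u} R)} (hS : S.ShortExact) (Y : ModuleCat.{u} R) (n : ℕ) :
    Function.Exact ((Abelian.Ext.mk₀ S.g).precompOfLinear R Y (zero_add n))
      ((Abelian.Ext.mk₀ S.f).precompOfLinear R Y (zero_add n)) := by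
  intro x
  constructor
  · exact Abelian.Ext.contravariant_sequence_exact₂ hS Y x
  · rintro ⟨y, rfl⟩
    change (Abelian.Ext.mk₀ S.f).comp ((Abelian.Ext.mk₀ S.g).comp y (zero_add n)) (zero_add n) = 0
    simp

lemma ModuleCat.subsingleton_ext_of_subsingleton (M N : ModuleCat.{u} R) (i : ℕ)
    [Subsingleton M] : Subsingleton (Abelian.Ext M N i) := by
  refine subsingleton_of_forall_eq 0 fun x => ?_
  rw [← Abelian.Ext.mk₀_id_comp x,
    (ModuleCat.isZero_of_subsingleton M).eq_of_src (𝟙 M) 0]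
  simp

lemma ModuleCat.smul_ext_eq_comp {M N : ModuleCat.{u} R} {i : ℕ} (x : R)
    (z : Abelian.Ext M N i) :
    x • z = (Abelian.Ext.mk₀ (x • 𝟙 M)).comp z (zero_add i) := by
  simp [Abelian.Ext.mk₀_smul]

lemma ModuleCat.smul_ext_eq_zero_of_mem_annihilator {M N : ModuleCat.{u} R} {i : ℕ} {x : R}
    (hx : x ∈ Module.annihilator R M) (z : Abelian.Ext M N i) : x • z = 0 := by
  have : x • 𝟙 M = 0 :=
    ModuleCat.hom_ext (LinearMap.ext fun m => Module.mem_annihilator.mp hx m)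
  rw [ModuleCat.smul_ext_eq_comp, this]
  simp

lemma ModuleCat.smul_ext_eq_comp_right {M N : ModuleCat.{u} R} {i : ℕ} (x : R)
    (z : Abelian.Ext M N i) :
    x • z = z.comp (Abelian.Ext.mk₀ (x • 𝟙 N)) (add_zero i) := by
  simp [Abelian.Ext.mk₀_smul]

variable [IsNoetherianRing R]

lemma ModuleCat.exists_prime_mem_support_ext (C : ModuleCat.{u} R) (q : PrimeSpectrum R) (i : ℕ)
    (N : Type u) [AddCommGroup N] [Module R N] [hN : Module.Finite R N]
    (hq : q ∈ Module.support R (Abelian.Ext (ModuleCat.of R N) C i)) :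
    ∃ p ∈ Module.support R N,
      q ∈ Module.support R (Abelian.Ext (ModuleCat.of R (R ⧸ p.asIdeal)) C i) := by
  induction hN using IsNoetherianRing.induction_on_isQuotientEquivQuotientPrime R with
  | subsingleton N =>
    rw [Module.support_eq_empty_iff.mpr (ModuleCat.subsingleton_ext_of_subsingleton _ C i)] at hq
    exact hq.elim
  | quotient N p e =>
    refine ⟨p, ?_, ?_⟩
    · rw [e.support_eq, Module.mem_support_iff_of_finite, Ideal.annihilator_quotient]
    · rwa [(ModuleCat.extLinearEquivOfIso e.toModuleIso C i).support_eq]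
  | exact N₁ N₂ N₃ f g hf hg hfg h₁ h₃ =>
    have hS := ModuleCat.shortComplex_shortExact
      (ModuleCat.shortComplexOfCompEqZero f g hfg.linearMap_comp_eq_zero) hfg hf hg
    rw [Module.support_of_exact hfg hf hg]
    rcases Module.support_subset_union_of_exact (hS.exact_precompOfLinear C i) hq with h | h
    · obtain ⟨p, hp, hp'⟩ := h₃ h
      exact ⟨p, Or.inr hp, hp'⟩
    · obtain ⟨p, hp, hp'⟩ := h₁ h
      exact ⟨p, Or.inl hp, hp'⟩

lemma ModuleCat.mem_support_ext_quotSMulTop (C : ModuleCat.{u} R) [Module.Finite R C]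
    (q : PrimeSpectrum R) (i : ℕ) (M : ModuleCat.{u} R) [Module.Finite R M] {x : R}
    (hx : IsSMulRegular M x) (hxq : x ∈ q.asIdeal)
    (hq : q ∈ Module.support R (Abelian.Ext M C i)) :
    q ∈ Module.support R (Abelian.Ext (ModuleCat.of R (QuotSMulTop x M)) C (i + 1)) := by
  have hS := hx.smulShortComplex_shortExact
  let δ : Abelian.Ext M C i →ₗ[R] Abelian.Ext (ModuleCat.of R (QuotSMulTop x M)) C (i + 1) :=
    hS.extClass.precompOfLinear R C (add_comm 1 i)
  have hker : LinearMap.ker δ = x • (⊤ : Submodule R (Abelian.Ext M C i)) := by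
    ext y
    rw [Submodule.mem_smul_pointwise_iff_exists, LinearMap.mem_ker]
    constructor
    · intro hy
      obtain ⟨z, hz⟩ := Abelian.Ext.contravariant_sequence_exact₁ hS C y (add_comm 1 i) hy
      exact ⟨z, trivial, (ModuleCat.smul_ext_eq_comp x z).trans hz⟩
    · rintro ⟨z, -, rfl⟩
      exact (congrArg δ (ModuleCat.smul_ext_eq_comp x z)).trans
        (hS.extClass_comp_assoc z (h := add_comm 1 i))
  let ψ : QuotSMulTop x (Abelian.Ext M C i) →ₗ[R] _ :=
    Submodule.liftQ (x • (⊤ : Submodule R (Abelian.Ext M C i))) δ hker.ge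
  have hψ : Function.Injective ψ := by
    rw [← LinearMap.ker_eq_bot]
    exact Submodule.ker_liftQ_eq_bot _ _ _ hker.le
  apply Module.support_subset_of_injective ψ hψ
  rw [Module.support_quotSMulTop]
  exact ⟨hq, by simpa using hxq⟩

end Support

section SupportChains

open Pointwise

universe u

variable {R : Type u} [CommRing R] (C : ModuleCat.{u} R)

lemma ModuleCat.le_of_mem_support_ext_quotient {p q : PrimeSpectrum R} {i : ℕ}
    (hq : q ∈ Module.support R
      (Abelian.Ext (ModuleCat.of R (R ⧸ p.asIdeal)) C i)) : p ≤ q := by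
  intro x hx
  refine Module.annihilator_le_of_mem_support hq (Module.mem_annihilator.mpr fun z =>
    ModuleCat.smul_ext_eq_zero_of_mem_annihilator ?_ z)
  change x ∈ Module.annihilator R (R ⧸ p.asIdeal)
  rwa [Ideal.annihilator_quotient]

variable [IsNoetherianRing R] [Module.Finite R C]

lemma ModuleCat.exists_prime_gt_mem_support_ext {p q : PrimeSpectrum R} {i : ℕ} (hpq : p < q)
    (hq : q ∈ Module.support R (Abelian.Ext (ModuleCat.of R (R ⧸ p.asIdeal)) C i)) :
    ∃ p' : PrimeSpectrum R, p < p' ∧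
      q ∈ Module.support R (Abelian.Ext (ModuleCat.of R (R ⧸ p'.asIdeal)) C (i + 1)) := by
  obtain ⟨x, hxq, hxp⟩ := Set.exists_of_ssubset (show p.asIdeal < q.asIdeal from hpq)
  have hx : IsSMulRegular (R ⧸ p.asIdeal) x := by
    rw [isSMulRegular_iff_right_eq_zero_of_smul]
    intro y hy
    obtain ⟨y, rfl⟩ := Ideal.Quotient.mk_surjective y
    rw [Algebra.smul_def, Ideal.Quotient.algebraMap_eq, ← map_mul,
      Ideal.Quotient.eq_zero_iff_mem] at hy
    exact Ideal.Quotient.eq_zero_iff_mem.mpr ((p.2.mem_or_mem hy).resolve_left hxp)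
  obtain ⟨p', hp', h⟩ := ModuleCat.exists_prime_mem_support_ext C q (i + 1) _
    (ModuleCat.mem_support_ext_quotSMulTop C q i (ModuleCat.of R (R ⧸ p.asIdeal)) hx hxq hq)
  refine ⟨p', ?_, h⟩
  rw [Module.support_quotSMulTop] at hp'
  have h1 : p ≤ p' := by
    have := hp'.1
    rwa [Module.mem_support_iff_of_finite, Ideal.annihilator_quotient] at this
  refine lt_of_le_of_ne h1 ?_
  rintro rfl
  exact hxp (hp'.2 rfl)

/-- If `q` lies in the support of `Ext^i(R/p, C)`, there is a strict chain of primes from `p` to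
`q`, of length `l` say, with `q` in the support of `Ext^(i+l)(R/q, C)`. -/
lemma ModuleCat.exists_ltSeries_mem_support_ext (q : PrimeSpectrum R) (p : PrimeSpectrum R) (i : ℕ)
    (hq : q ∈ Module.support R (Abelian.Ext (ModuleCat.of R (R ⧸ p.asIdeal)) C i)) :
    ∃ s : LTSeries (PrimeSpectrum R), s.head = p ∧ s.last = q ∧
      q ∈ Module.support R
        (Abelian.Ext (ModuleCat.of R (R ⧸ q.asIdeal)) C (i + s.length)) := by
  have : WellFoundedGT (PrimeSpectrum R) :=
    ⟨InvImage.wf PrimeSpectrum.asIdeal (wellFounded_gt (α := Ideal R))⟩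
  induction p using WellFoundedGT.induction generalizing i with
  | ind p ih =>
    rcases (ModuleCat.le_of_mem_support_ext_quotient C hq).eq_or_lt with rfl | hlt
    · exact ⟨RelSeries.singleton _ p, rfl, rfl, hq⟩
    · obtain ⟨p', hp', h⟩ := ModuleCat.exists_prime_gt_mem_support_ext C hlt hq
      obtain ⟨s, rfl, hs, hs'⟩ := ih p' hp' (i + 1) h
      refine ⟨s.cons p hp', by simp, by simpa using hs, ?_⟩
      rwa [RelSeries.cons_length, add_comm s.length, ← add_assoc]

end SupportChains

section LocalVanishing

open Pointwise IsLocalRing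

universe u

variable {R : Type u} [CommRing R] [IsLocalRing R]

lemma ModuleCat.closedPoint_mem_support_ext (M C : ModuleCat.{u} R) [Module.Finite R M]
    [Module.Finite R C] (i : ℕ) (h : ¬ Subsingleton (Abelian.Ext M C i)) :
    closedPoint R ∈ Module.support R (Abelian.Ext M C i) := by
  rw [not_subsingleton_iff_nontrivial, ← Module.nonempty_support_iff (R := R)] at h
  obtain ⟨p, hp⟩ := h
  exact Module.mem_support_mono (IsLocalRing.le_maximalIdeal p.2.ne_top) hp

variable [IsNoetherianRing R]

lemma ModuleCat.subsingleton_ext_of_residueField (C : ModuleCat.{u} R) [Module.Finite R C] (i : ℕ)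
    (h : ∀ j, i ≤ j → Subsingleton (Abelian.Ext (ModuleCat.of R (R ⧸ maximalIdeal R)) C j))
    (M : ModuleCat.{u} R) [Module.Finite R M] : Subsingleton (Abelian.Ext M C i) := by
  by_contra hM
  obtain ⟨p, -, hp⟩ := ModuleCat.exists_prime_mem_support_ext C _ i M
    (ModuleCat.closedPoint_mem_support_ext M C i hM)
  obtain ⟨s, -, -, hs⟩ := ModuleCat.exists_ltSeries_mem_support_ext C _ p i hp
  have hnt := Module.nonempty_support_iff.mp ⟨_, hs⟩
  exact not_nontrivial_iff_subsingleton.mpr (h (i + s.length) (by lia)) hnt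

/-- If the residue field embeds in a finitely generated module `L` with
`Ext^i(L, C) = 0` for `i > n`, then the injective dimension of `C`, if finite, is at most `n`. -/
lemma ModuleCat.subsingleton_ext_of_injective_residueField (C : ModuleCat.{u} R)
    [Module.Finite R C] {N : ℕ} (hN : ∀ (M : ModuleCat.{u} R) [Module.Finite R M] (i : ℕ),
      N < i → Subsingleton (Abelian.Ext M C i))
    (L : ModuleCat.{u} R) [Module.Finite R L] {n : ℕ}
    (hL : ∀ i, n < i → Subsingleton (Abelian.Ext L C i))
    (f : (R ⧸ maximalIdeal R) →ₗ[R] L) (hf : Function.Injective f)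
    (M : ModuleCat.{u} R) [Module.Finite R M] (i : ℕ) (hi : n < i) :
    Subsingleton (Abelian.Ext M C i) := by
  suffices ∀ (t i : ℕ), n < i → N < i + t → ∀ (M : ModuleCat.{u} R) [Module.Finite R M],
      Subsingleton (Abelian.Ext M C i) from this N i hi (by lia) M
  intro t
  induction t with
  | zero => intro i _ hi M _; exact hN M i hi
  | succ t ih =>
    intro i hi hit M _
    refine ModuleCat.subsingleton_ext_of_residueField C i (fun j hj => ?_) M
    have hS := ModuleCat.shortComplex_shortExact (ModuleCat.shortComplexOfCompEqZero f
      (LinearMap.range f).mkQ (LinearMap.range_mkQ_comp f))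
      (LinearMap.exact_map_mkQ_range f) hf (Submodule.mkQ_surjective _)
    exact hS.subsingleton_ext_left₁ C j (hL j (by lia))
      (ih (j + 1) (by lia) (by lia) (ModuleCat.of R (L ⧸ LinearMap.range f)))

lemma ModuleCat.exists_isSMulRegular_of_subsingleton_ext_zero (M : ModuleCat.{u} R)
    [Module.Finite R M]
    (h : Subsingleton (Abelian.Ext (ModuleCat.of R (R ⧸ maximalIdeal R)) M 0)) :
    ∃ x ∈ maximalIdeal R, IsSMulRegular M x := by
  have : Subsingleton ((R ⧸ maximalIdeal R) →ₗ[R] M) :=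
    (Abelian.Ext.addEquiv₀.trans
      (ModuleCat.homAddEquiv (M := ModuleCat.of R (R ⧸ maximalIdeal R)))).symm.toEquiv.subsingleton
  simpa [Ideal.annihilator_quotient] using IsSMulRegular.subsingleton_linearMap_iff.mp this

lemma ModuleCat.exists_injective_residueField (C : ModuleCat.{u} R) (n s : ℕ)
    (M : ModuleCat.{u} R) [Module.Finite R M]
    (hM : ∀ i, s < i → Subsingleton (Abelian.Ext M C i))
    (h : ∀ i < n, Subsingleton (Abelian.Ext (ModuleCat.of R (R ⧸ maximalIdeal R)) M i))
    (hn : ¬ Subsingleton (Abelian.Ext (ModuleCat.of R (R ⧸ maximalIdeal R)) M n)) :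
    ∃ (L : ModuleCat.{u} R) (_ : Module.Finite R L) (f : (R ⧸ maximalIdeal R) →ₗ[R] L),
      Function.Injective f ∧ ∀ i, s + n < i → Subsingleton (Abelian.Ext L C i) := by
  induction n generalizing s M with
  | zero =>
    have : Nontrivial ((R ⧸ maximalIdeal R) →ₗ[R] M) := by
      rw [not_subsingleton_iff_nontrivial] at hn
      exact (Abelian.Ext.addEquiv₀.trans
        (ModuleCat.homAddEquiv (M := ModuleCat.of R (R ⧸ maximalIdeal R)))).symm.toEquiv.nontrivial
    obtain ⟨f, hf⟩ := exists_ne (0 : (R ⧸ maximalIdeal R) →ₗ[R] M)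
    have : IsSimpleModule R (R ⧸ maximalIdeal R) :=
      isSimpleModule_iff_isCoatom.mpr (maximalIdeal.isMaximal R).1
    exact ⟨M, ‹_›, f, LinearMap.injective_of_ne_zero hf, hM⟩
  | succ n ih =>
    obtain ⟨x, hx, hxM⟩ := ModuleCat.exists_isSMulRegular_of_subsingleton_ext_zero M
      (h 0 (by lia))
    have hS := hxM.smulShortComplex_shortExact
    have := ih (s + 1) (ModuleCat.of R (QuotSMulTop x M)) ?_ ?_ ?_
    · obtain ⟨L, hL, f, hf, hLC⟩ := this
      exact ⟨L, hL, f, hf, fun i hi => hLC i (by lia)⟩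
    · rintro (_ | i) hi
      · lia
      · exact hS.subsingleton_ext_left₃ C i (hM i (by lia)) (hM (i + 1) (by lia))
    · intro i hi
      exact hS.subsingleton_ext_right₃ _ i (h i (by lia)) (h (i + 1) (by lia))
    · intro hsub
      refine hn (subsingleton_of_forall_eq 0 fun z => ?_)
      obtain ⟨y, rfl⟩ := Abelian.Ext.covariant_sequence_exact₁ _ hS z (by
        refine Eq.trans ?_ (ModuleCat.smul_ext_eq_zero_of_mem_annihilator (x := x) ?_ z)
        · rw [ModuleCat.smul_ext_eq_comp_right]
          rfl
        · change x ∈ Module.annihilator R (R ⧸ maximalIdeal R)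
          rwa [Ideal.annihilator_quotient]) rfl
      simp only [hsub.elim y 0]
      exact Abelian.Ext.zero_comp _ _ hS.extClass _ _

lemma ModuleCat.subsingleton_ext_of_depth (C : ModuleCat.{u} R)
    [Module.Finite R C] {N : ℕ} (hN : ∀ (M : ModuleCat.{u} R) [Module.Finite R M] (i : ℕ),
      N < i → Subsingleton (Abelian.Ext M C i)) {n : ℕ}
    (h : ∀ i < n, Subsingleton (Abelian.Ext (ModuleCat.of R (R ⧸ maximalIdeal R))
      (ModuleCat.of R R) i))
    (hn : ¬ Subsingleton (Abelian.Ext (ModuleCat.of R (R ⧸ maximalIdeal R)) (ModuleCat.of R R) n))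
    (M : ModuleCat.{u} R) [Module.Finite R M] (i : ℕ) (hi : n < i) :
    Subsingleton (Abelian.Ext M C i) := by
  obtain ⟨L, hL, f, hf, hLC⟩ := ModuleCat.exists_injective_residueField C n 0 (ModuleCat.of R R)
    (fun i hi => subsingleton_of_forall_eq 0 fun z => by
      obtain ⟨i, rfl⟩ : ∃ j, i = j + 1 := ⟨i - 1, by lia⟩
      exact z.eq_zero_of_projective) h hn
  exact ModuleCat.subsingleton_ext_of_injective_residueField C hN L
    (fun i hi => hLC i (by lia)) f hf M i hi

end LocalVanishing

section CohenMacaulay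

open IsLocalRing

universe u

variable {R : Type u} [CommRing R]

lemma ModuleCat.mem_support_ext_zero_of_mem_associatedPrimes [IsNoetherianRing R]
    (C : ModuleCat.{u} R) {p : PrimeSpectrum R} (hp : p.asIdeal ∈ associatedPrimes R C) :
    p ∈ Module.support R (Abelian.Ext (ModuleCat.of R (R ⧸ p.asIdeal)) C 0) := by
  obtain ⟨-, f, hf⟩ := (isAssociatedPrime_iff_exists_injective_linearMap _ _).mp hp
  refine Module.mem_support_iff'.mpr ⟨Abelian.Ext.mk₀ (ModuleCat.ofHom f), fun r hr h => hr ?_⟩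
  rw [← Abelian.Ext.mk₀_smul, Abelian.Ext.mk₀_eq_zero_iff] at h
  have h1 : r • f 1 = 0 := LinearMap.congr_fun (congrArg ModuleCat.Hom.hom h) 1
  rw [← map_smul, ← map_zero f] at h1
  have h2 := hf h1
  rwa [Algebra.smul_def, mul_one, Ideal.Quotient.algebraMap_eq,
    Ideal.Quotient.eq_zero_iff_mem] at h2

variable [IsNoetherianRing R]

lemma ModuleCat.exists_mem_support_ext_of_le (C : ModuleCat.{u} R) [Module.Finite R C]
    {p q : PrimeSpectrum R} (h : p ≤ q) {i : ℕ}
    (hp : p ∈ Module.support R (Abelian.Ext (ModuleCat.of R (R ⧸ p.asIdeal)) C i)) :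
    ∃ s : LTSeries (PrimeSpectrum R), s.head = p ∧ s.last = q ∧
      q ∈ Module.support R
        (Abelian.Ext (ModuleCat.of R (R ⧸ q.asIdeal)) C (i + s.length)) :=
  ModuleCat.exists_ltSeries_mem_support_ext C q p i (Module.mem_support_mono h hp)

lemma ModuleCat.exists_mem_support_ext_ltSeries (C : ModuleCat.{u} R) [Module.Finite R C]
    (s : LTSeries (PrimeSpectrum R))
    (hs : s.head ∈ Module.support R (Abelian.Ext (ModuleCat.of R (R ⧸ s.head.asIdeal)) C 0)) :
    ∃ i, s.length ≤ i ∧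
      s.last ∈ Module.support R (Abelian.Ext (ModuleCat.of R (R ⧸ s.last.asIdeal)) C i) := by
  suffices ∀ (n : ℕ) (hn : n < s.length + 1), ∃ i, n ≤ i ∧ s ⟨n, hn⟩ ∈ Module.support R
      (Abelian.Ext (ModuleCat.of R (R ⧸ (s ⟨n, hn⟩).asIdeal)) C i) from
    this s.length (Nat.lt_succ_self _)
  intro n
  induction n with
  | zero => exact fun hn => ⟨0, le_rfl, hs⟩
  | succ n ih =>
    intro hn
    obtain ⟨i, hi, h⟩ := ih (by lia)
    have hlt : s ⟨n, by lia⟩ < s ⟨n + 1, hn⟩ := s.strictMono (by simp)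
    obtain ⟨t, ht, ht', h'⟩ := ModuleCat.exists_mem_support_ext_of_le C hlt.le h
    refine ⟨i + t.length, ?_, h'⟩
    have : t.length ≠ 0 := by
      intro h0
      rw [← ht, ← ht'] at hlt
      exact hlt.ne (congrArg t (Fin.ext h0.symm))
    lia

/-- A noetherian local ring with a faithful finitely generated module of finite injective
dimension is Cohen–Macaulay. -/
lemma ModuleCat.exists_ringKrullDim_eq_of_finite_injectiveDimension [IsLocalRing R]
    (C : ModuleCat.{u} R) [Module.Finite R C] (hC : Module.annihilator R C = ⊥) {N : ℕ}
    (hN : ∀ (M : ModuleCat.{u} R) [Module.Finite R M] (i : ℕ),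
      N < i → Subsingleton (Abelian.Ext M C i)) :
    ∃ d : ℕ, ringKrullDim R = d ∧ ∀ i < d,
      Subsingleton (Abelian.Ext (ModuleCat.of R (R ⧸ maximalIdeal R)) (ModuleCat.of R R) i) := by
  let s := LTSeries.longestOf (PrimeSpectrum R)
  refine ⟨s.length, Order.krullDim_eq_length_of_finiteDimensionalOrder, ?_⟩
  intro i
  induction i using Nat.strong_induction_on with
  | h n ih =>
  intro hn
  by_contra hsub
  have hA := ModuleCat.subsingleton_ext_of_depth C hN (fun i hi => ih i hi (hi.trans hn)) hsub
  obtain ⟨p, hp, hps⟩ := Ideal.exists_minimalPrimes_le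
    (I := Module.annihilator R C) (J := s.head.asIdeal) (hC.trans_le bot_le)
  let p' : PrimeSpectrum R := ⟨p, hp.1.1⟩
  have h0 := ModuleCat.mem_support_ext_zero_of_mem_associatedPrimes C (p := p')
    (Module.associatedPrimes.minimalPrimes_annihilator_subset_associatedPrimes R C hp)
  have hp' : p' = s.head := by
    refine (eq_or_lt_of_le (show p' ≤ s.head from hps)).resolve_right fun hlt => ?_
    have := RelSeries.length_le_length_longestOf _ (s.cons p' hlt)
    rw [RelSeries.cons_length] at this
    exact Nat.not_succ_le_self _ this
  rw [hp'] at h0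
  obtain ⟨i, hi, h⟩ := ModuleCat.exists_mem_support_ext_ltSeries C s h0
  have hnt := Module.nonempty_support_iff.mp ⟨_, h⟩
  exact not_nontrivial_iff_subsingleton.mpr
    (hA (ModuleCat.of R (R ⧸ s.last.asIdeal)) i (by lia)) hnt

end CohenMacaulay

section ChangeOfRings

universe u

variable {A B : Type u} [CommRing A] [CommRing B] (f : A →+* B)

namespace ModuleCat

lemma exists_injective_shortExact (C : ModuleCat.{u} A) :
    ∃ S : ShortComplex (ModuleCat.{u} A), S.ShortExact ∧ S.X₁ = C ∧ Injective S.X₂ :=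
  ⟨ShortComplex.mk (Injective.ι C) (Limits.cokernel.π _) (Limits.cokernel.condition _),
    { exact := ShortComplex.exact_cokernel _
      mono_f := inferInstanceAs (Mono (Injective.ι C))
      epi_g := inferInstanceAs (Epi (Limits.cokernel.π (Injective.ι C))) }, rfl,
    inferInstanceAs (Injective (Injective.under C))⟩

instance injective_coextendScalars_obj (I : ModuleCat.{u} A) [Injective I] :
    Injective ((coextendScalars.{u, u, u} f).obj I) :=
  Injective.injective_of_adjoint (restrictCoextendScalarsAdj.{u, u, u} f) I

lemma exists_lift_coextendScalars {S : ShortComplex (ModuleCat.{u} A)} (hS : S.ShortExact)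
    (M : ModuleCat.{u} B)
    (h : Subsingleton (Abelian.Ext ((restrictScalars f).obj M) S.X₁ 1))
    (y : M ⟶ (coextendScalars.{u, u, u} f).obj S.X₃) :
    ∃ z, z ≫ (coextendScalars.{u, u, u} f).map S.g = y := by
  let adj := restrictCoextendScalarsAdj.{u, u, u} f
  obtain ⟨w, hw⟩ := Abelian.Ext.covariant_sequence_exact₃ _ hS
    (Abelian.Ext.mk₀ ((adj.homEquiv _ _).symm y)) (zero_add 1) (Subsingleton.elim _ _)
  obtain ⟨w, rfl⟩ := (Abelian.Ext.mk₀_bijective _ _).2 w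
  rw [Abelian.Ext.mk₀_comp_mk₀] at hw
  refine ⟨adj.homEquiv _ _ w, ?_⟩
  rw [← adj.homEquiv_naturality_right, (Abelian.Ext.mk₀_bijective _ _).1 hw,
    Equiv.apply_symm_apply]

lemma shortExact_map_coextendScalars {S : ShortComplex (ModuleCat.{u} A)} (hS : S.ShortExact)
    (h : Subsingleton (Abelian.Ext ((restrictScalars f).obj (ModuleCat.of B B)) S.X₁ 1)) :
    haveI := (restrictCoextendScalarsAdj.{u, u, u} f).right_adjoint_additive
    (S.map (coextendScalars.{u, u, u} f)).ShortExact := by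
  have := (restrictCoextendScalarsAdj.{u, u, u} f).right_adjoint_additive
  have hlim : Limits.PreservesLimitsOfSize.{0, 0} (coextendScalars.{u, u, u} f) :=
    (restrictCoextendScalarsAdj.{u, u, u} f).rightAdjoint_preservesLimits
  have hmono := Functor.preservesMonomorphisms_of_adjunction
    (restrictCoextendScalarsAdj.{u, u, u} f)
  have := hS.mono_f
  exact
  { exact := hS.exact.map_of_mono_of_preservesKernel _ ‹_›
      ((hlim.preservesLimitsOfShape (J := Limits.WalkingParallelPair)).preservesLimit)
    mono_f := hmono.preserves S.f
    epi_g := by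
      rw [ModuleCat.epi_iff_surjective]
      intro y
      obtain ⟨z, hz⟩ := exists_lift_coextendScalars f hS (ModuleCat.of B B) h
        (ModuleCat.ofHom (LinearMap.toSpanSingleton B _ y))
      refine ⟨z.hom 1, ?_⟩
      exact (LinearMap.congr_fun (congrArg ModuleCat.Hom.hom hz) 1).trans
        (LinearMap.toSpanSingleton_apply_one B _ y) }

/-- If `Ext_A^j(B, C) = 0` for `j ≥ 1`, vanishing of `Ext_A^i(M, C)` implies that of
`Ext_B^i(M, Hom_A(B, C))`. -/
lemma subsingleton_ext_coextendScalars (C : ModuleCat.{u} A)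
    (hC : ∀ j, Subsingleton (Abelian.Ext ((restrictScalars f).obj (ModuleCat.of B B)) C (j + 1)))
    (M : ModuleCat.{u} B) (i : ℕ)
    (h : Subsingleton (Abelian.Ext ((restrictScalars f).obj M) C (i + 1))) :
    Subsingleton (Abelian.Ext M ((coextendScalars.{u, u, u} f).obj C) (i + 1)) := by
  have hI' (I X : ModuleCat.{u} A) [Injective I] (j : ℕ) :
      Subsingleton (Abelian.Ext X I (j + 1)) :=
    subsingleton_of_forall_eq 0 fun x => x.eq_zero_of_injective
  have hI'' (I : ModuleCat.{u} A) [Injective I] (j : ℕ) :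
      Subsingleton (Abelian.Ext M ((coextendScalars.{u, u, u} f).obj I) (j + 1)) :=
    subsingleton_of_forall_eq 0 fun x => x.eq_zero_of_injective
  induction i generalizing C with
  | zero =>
    obtain ⟨S, hS, rfl, hI⟩ := exists_injective_shortExact C
    have hG := shortExact_map_coextendScalars f hS (hC 0)
    refine subsingleton_of_forall_eq 0 fun x => ?_
    obtain ⟨y, rfl⟩ := Abelian.Ext.covariant_sequence_exact₁ _ hG x
      ((hI'' S.X₂ 0).elim _ _) rfl
    obtain ⟨y, rfl⟩ := (Abelian.Ext.mk₀_bijective _ _).2 y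
    obtain ⟨z, rfl⟩ : ∃ z, z ≫ (S.map (coextendScalars.{u, u, u} f)).g = y :=
      exists_lift_coextendScalars f hS M h y
    rw [← Abelian.Ext.mk₀_comp_mk₀_assoc, hG.comp_extClass, Abelian.Ext.comp_zero]
    rfl
  | succ i ih =>
    obtain ⟨S, hS, rfl, hI⟩ := exists_injective_shortExact C
    have hG := shortExact_map_coextendScalars f hS (hC 0)
    exact hG.subsingleton_ext_right₁ _ _ (ih S.X₃
      (fun j => hS.subsingleton_ext_right₃ _ _ (hI' _ _ _) (hC (j + 1)))
      (hS.subsingleton_ext_right₃ _ _ (hI' _ _ _) h)) (hI'' S.X₂ _)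

end ModuleCat

end ChangeOfRings

section TrivialExtension

universe u

lemma ModuleCat.subsingleton_ext_of_bijective {A B : Type u} [CommRing A] [CommRing B] (f : A →+* B)
    (C : ModuleCat.{u} A) (D : ModuleCat.{u} B) (g : D ⟶ (coextendScalars.{u, u, u} f).obj C)
    (hg : Function.Bijective g.hom)
    (hC : ∀ j, Subsingleton (Abelian.Ext ((restrictScalars f).obj (ModuleCat.of B B)) C (j + 1)))
    (M : ModuleCat.{u} B) (i : ℕ)
    (h : Subsingleton (Abelian.Ext ((restrictScalars f).obj M) C (i + 1))) :
    Subsingleton (Abelian.Ext M D (i + 1)) := by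
  have : IsIso g := (ConcreteCategory.isIso_iff_bijective _).mpr hg
  exact (extEquivOfIsoRight M (asIso g) _).subsingleton_congr.mpr
    (subsingleton_ext_coextendScalars f C hC M i h)

variable {R : Type u} [CommRing R] (C : Type u) [AddCommGroup C] [Module R C] [Module Rᵐᵒᵖ C]
  [IsCentralScalar R C]

namespace TrivSqZeroExt

lemma isNoetherianRing [IsNoetherianRing R] [Module.Finite R C] :
    IsNoetherianRing (TrivSqZeroExt R C) := by
  have : Module.Finite R (TrivSqZeroExt R C) := inferInstanceAs (Module.Finite R (R × C))
  exact isNoetherian_of_tower R inferInstance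

lemma isLocalRing [IsLocalRing R] : IsLocalRing (TrivSqZeroExt R C) := by
  refine IsLocalRing.of_nonunits_add fun a b ha hb => ?_
  rw [mem_nonunits_iff, isUnit_iff_isUnit_fst] at *
  exact IsLocalRing.nonunits_add ha hb

/-- The trivial extension, as a module over the base ring, is the product. -/
def restrictScalarsInlHomEquiv :
    (ModuleCat.restrictScalars (inlHom R C)).obj (ModuleCat.of (TrivSqZeroExt R C)
      (TrivSqZeroExt R C)) ≃ₗ[R] R × C where
  toFun x := (fst (R := R) (M := C) x, snd (R := R) (M := C) x)
  invFun x := (inl x.1 + inr x.2 : TrivSqZeroExt R C)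
  map_add' x y := rfl
  map_smul' r x := by
    let y : TrivSqZeroExt R C := x
    change (fst (inl r * y), snd (inl r * y)) = (r • fst y, r • snd y)
    simp
  left_inv x := inl_fst_add_inr_snd_eq x
  right_inv x := by simp

/-- The map from the trivial extension to `Hom_R(R ⋉ C, C)` given by multiplication followed by
the second projection. -/
noncomputable def toCoextendScalars : ModuleCat.of (TrivSqZeroExt R C) (TrivSqZeroExt R C) ⟶
    (ModuleCat.coextendScalars.{u, u, u} (inlHom R C)).obj (ModuleCat.of R C) :=
  (ModuleCat.restrictCoextendScalarsAdj.{u, u, u} (inlHom R C)).homEquiv _ _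
    (ModuleCat.ofHom (X := (ModuleCat.restrictScalars (inlHom R C)).obj
      (ModuleCat.of (TrivSqZeroExt R C) (TrivSqZeroExt R C)))
      (LinearMap.snd R R C ∘ₗ (restrictScalarsInlHomEquiv C).toLinearMap))

lemma toCoextendScalars_apply (x y : TrivSqZeroExt R C) :
    (ModuleCat.CoextendScalars.equiv (inlHom R C) (ModuleCat.of R C)
      ((toCoextendScalars C).hom x)) y = snd (y * x) :=
  rfl

lemma bijective_toCoextendScalars (hC : Function.Bijective (LinearMap.lsmul R C)) :
    Function.Bijective (toCoextendScalars (R := R) C).hom := by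
  constructor
  · rw [← LinearMap.ker_eq_bot, eq_bot_iff]
    intro x hx
    have h (y : TrivSqZeroExt R C) : snd (y * (show TrivSqZeroExt R C from x)) = 0 := by
      rw [← toCoextendScalars_apply, LinearMap.mem_ker.mp hx]
      rfl
    refine TrivSqZeroExt.ext ?_ ?_
    · change fst (show TrivSqZeroExt R C from x) = 0
      refine hC.1 (LinearMap.ext fun c => ?_)
      simpa using h (inr c)
    · simpa using h 1
  · intro g
    let h := ModuleCat.CoextendScalars.equiv (inlHom R C) (ModuleCat.of R C) g
    let h' : R × C →ₗ[R] C := h ∘ₗ (restrictScalarsInlHomEquiv (R := R) C).symm.toLinearMap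
    obtain ⟨r, hr⟩ := hC.2 (h' ∘ₗ LinearMap.inr R R C)
    refine ⟨(inl r + inr (h' (1, 0)) : TrivSqZeroExt R C),
      ModuleCat.CoextendScalars.ext (LinearMap.ext fun (y : TrivSqZeroExt R C) => ?_)⟩
    refine (toCoextendScalars_apply C _ y).trans ?_
    have h1 : h y = h' (fst y, snd y) :=
      congrArg h ((restrictScalarsInlHomEquiv (R := R) C).symm_apply_apply y).symm
    have h2 : h' (fst y, snd y) = fst y • h' (1, 0) + r • snd y := by
      have h3 : r • snd y = h' (0, snd y) := LinearMap.congr_fun hr (snd y)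
      rw [h3, ← map_smul, ← map_add]
      simp
    refine Eq.trans ?_ (h1.trans h2).symm
    simp

lemma subsingleton_ext_restrictScalars (i : ℕ)
    (h : Subsingleton (Abelian.Ext (ModuleCat.of R C) (ModuleCat.of R C) (i + 1))) :
    Subsingleton (Abelian.Ext ((ModuleCat.restrictScalars (inlHom R C)).obj
      (ModuleCat.of (TrivSqZeroExt R C) (TrivSqZeroExt R C))) (ModuleCat.of R C) (i + 1)) := by
  refine (ModuleCat.extLinearEquivOfIso
    (restrictScalarsInlHomEquiv (R := R) C).toModuleIso _ _).symm.toEquiv.subsingleton_congr.mpr ?_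
  have hfg : Function.Exact (LinearMap.inr R R C) (LinearMap.fst R R C) := by
    rw [LinearMap.exact_iff, LinearMap.range_inr]
  have hS := ModuleCat.shortComplex_shortExact
      (ModuleCat.shortComplexOfCompEqZero (LinearMap.inr R R C) (LinearMap.fst R R C)
        hfg.linearMap_comp_eq_zero) hfg LinearMap.inr_injective LinearMap.fst_surjective
  exact hS.subsingleton_ext_left₂ _ _ h
    (subsingleton_of_forall_eq 0 fun x =>
      Abelian.Ext.eq_zero_of_projective (P := ModuleCat.of R R) x)

/-- If `C` is a module with `R ≅ Hom(C, C)` and `Ext^i(C, C) = 0` for `i ≥ 1`, the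
self-injective dimension of the trivial extension `R ⋉ C` is at most the injective
dimension of `C`. -/
lemma subsingleton_ext_self (hC : Function.Bijective (LinearMap.lsmul R C))
    (hCC : ∀ i, Subsingleton (Abelian.Ext (ModuleCat.of R C) (ModuleCat.of R C) (i + 1))) {N : ℕ}
    (hN : ∀ (M : ModuleCat.{u} R) (i : ℕ), N < i →
      Subsingleton (Abelian.Ext M (ModuleCat.of R C) i))
    (M : ModuleCat.{u} (TrivSqZeroExt R C)) (i : ℕ) (hi : N < i) :
    Subsingleton (Abelian.Ext M (ModuleCat.of (TrivSqZeroExt R C) (TrivSqZeroExt R C)) i) := by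
  obtain ⟨i, rfl⟩ : ∃ j, i = j + 1 := ⟨i - 1, by lia⟩
  exact ModuleCat.subsingleton_ext_of_bijective (inlHom R C) (ModuleCat.of R C) _
    (toCoextendScalars (R := R) C) (bijective_toCoextendScalars C hC)
    (fun j => subsingleton_ext_restrictScalars C j (hCC j)) M i
    (hN ((ModuleCat.restrictScalars (inlHom R C)).obj M) (i + 1) hi)

end TrivSqZeroExt

end TrivialExtension

section Biduality

universe u

variable {Q : Type u} [CommRing Q]

namespace ModuleCat

lemma exists_comp_eq_of_subsingleton_ext_one {K F M : Type u} [AddCommGroup K] [Module Q K]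
    [AddCommGroup F] [Module Q F] [AddCommGroup M] [Module Q M] (C : ModuleCat.{u} Q)
    {f : K →ₗ[Q] F} {g : F →ₗ[Q] M}
    (hfg : Function.Exact f g) (hf : Function.Injective f) (hg : Function.Surjective g)
    (h : Subsingleton (Abelian.Ext (ModuleCat.of Q M) C 1)) (φ : K →ₗ[Q] C) :
    ∃ ψ : F →ₗ[Q] C, ψ ∘ₗ f = φ := by
  have hS := ModuleCat.shortComplex_shortExact
    (ModuleCat.shortComplexOfCompEqZero f g hfg.linearMap_comp_eq_zero) hfg hf hg
  obtain ⟨y, hy⟩ := Abelian.Ext.contravariant_sequence_exact₁ hS C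
    (Abelian.Ext.mk₀ (ModuleCat.ofHom φ)) (add_zero 1) (h.elim _ _)
  obtain ⟨y, rfl⟩ := (Abelian.Ext.mk₀_bijective _ _).2 y
  rw [Abelian.Ext.mk₀_comp_mk₀] at hy
  exact ⟨y.hom, congrArg ModuleCat.Hom.hom ((Abelian.Ext.mk₀_bijective _ _).1 hy)⟩

lemma exists_finite_free_exact [IsNoetherianRing Q] (M : Type u) [AddCommGroup M] [Module Q M]
    [Module.Finite Q M] :
    ∃ (n : ℕ) (K : Type u) (_ : AddCommGroup K) (_ : Module Q K) (_ : Module.Finite Q K)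
      (f : K →ₗ[Q] (Fin n → Q)) (g : (Fin n → Q) →ₗ[Q] M),
      Function.Exact f g ∧ Function.Injective f ∧ Function.Surjective g := by
  obtain ⟨n, g, hg⟩ := Module.Finite.exists_fin' Q M
  exact ⟨n, LinearMap.ker g, inferInstance, inferInstance, inferInstance,
    (LinearMap.ker g).subtype, g, LinearMap.exact_subtype_ker_map g,
    Submodule.subtype_injective _, hg⟩

lemma subsingleton_ext_succ_of_projective (P C : ModuleCat.{u} Q) [Module.Projective Q P] (i : ℕ) :
    Subsingleton (Abelian.Ext P C (i + 1)) := by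
  have : CategoryTheory.Projective P := (IsProjective.iff_projective P).mp inferInstance
  exact subsingleton_of_forall_eq 0 fun x => x.eq_zero_of_projective

section

variable {K F M : Type u} [AddCommGroup K] [Module Q K]
    [AddCommGroup F] [Module Q F] [Module.Projective Q F] [AddCommGroup M] [Module Q M]
    {f : K →ₗ[Q] F} {g : F →ₗ[Q] M}

lemma subsingleton_ext_syzygy (C : ModuleCat.{u} Q)
    (hfg : Function.Exact f g) (hf : Function.Injective f) (hg : Function.Surjective g)
    (i : ℕ) (h : Subsingleton (Abelian.Ext (ModuleCat.of Q M) C (i + 2))) :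
    Subsingleton (Abelian.Ext (ModuleCat.of Q K) C (i + 1)) :=
  (ModuleCat.shortComplex_shortExact
    (ModuleCat.shortComplexOfCompEqZero f g hfg.linearMap_comp_eq_zero) hfg hf
      hg).subsingleton_ext_left₁
    C (i + 1) (subsingleton_ext_succ_of_projective (ModuleCat.of Q F) C i) h

end

section

variable [IsNoetherianRing Q]

lemma subsingleton_ext_dual {N : ℕ}
    (hN : ∀ (M : ModuleCat.{u} Q) [Module.Finite Q M] (i : ℕ), N < i →
      Subsingleton (Abelian.Ext M (ModuleCat.of Q Q) i))
    (M : Type u) [AddCommGroup M] [Module Q M] [Module.Finite Q M]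
    (hM : ∀ i, Subsingleton (Abelian.Ext (ModuleCat.of Q M) (ModuleCat.of Q Q) (i + 1))) (i : ℕ) :
    Subsingleton (Abelian.Ext (ModuleCat.of Q (Module.Dual Q M)) (ModuleCat.of Q Q) (i + 1)) := by
  suffices H : ∀ k i : ℕ, N < i + 1 + k → ∀ (M : Type u) [AddCommGroup M] [Module Q M]
      [Module.Finite Q M],
      (∀ i, Subsingleton (Abelian.Ext (ModuleCat.of Q M) (ModuleCat.of Q Q) (i + 1))) →
      Subsingleton (Abelian.Ext (ModuleCat.of Q (Module.Dual Q M)) (ModuleCat.of Q Q) (i + 1)) from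
    H N i (by lia) M hM
  intro k
  induction k with
  | zero => exact fun i hi M _ _ _ _ => hN (ModuleCat.of Q (Module.Dual Q M)) (i + 1) hi
  | succ k ih =>
    intro i hi M _ _ _ hM
    obtain ⟨n, K, _, _, _, f, g, hfg, hf, hg⟩ := exists_finite_free_exact (Q := Q) M
    exact subsingleton_ext_syzygy _ (LinearMap.exact_lcomp_of_exact_of_surjective Q hfg hg)
      (LinearMap.dualMap_injective_of_surjective hg)
      (exists_comp_eq_of_subsingleton_ext_one (ModuleCat.of Q Q) hfg hf hg (hM 0)) i
      (ih (i + 1) (by lia) K fun j => subsingleton_ext_syzygy _ hfg hf hg j (hM (j + 1)))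

lemma surjective_dual_eval {N : ℕ}
    (hN : ∀ (M : ModuleCat.{u} Q) [Module.Finite Q M] (i : ℕ), N < i →
      Subsingleton (Abelian.Ext M (ModuleCat.of Q Q) i))
    (M : Type u) [AddCommGroup M] [Module Q M] [Module.Finite Q M]
    (hM : ∀ i, Subsingleton (Abelian.Ext (ModuleCat.of Q M) (ModuleCat.of Q Q) (i + 1))) :
    Function.Surjective (Module.Dual.eval Q M) := by
  intro φ
  obtain ⟨n, K, _, _, _, f, g, hfg, hf, hg⟩ := exists_finite_free_exact (Q := Q) M
  obtain ⟨ψ, hψ⟩ := exists_comp_eq_of_subsingleton_ext_one (ModuleCat.of Q Q)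
    (LinearMap.exact_lcomp_of_exact_of_surjective Q hfg hg)
    (LinearMap.dualMap_injective_of_surjective hg)
    (exists_comp_eq_of_subsingleton_ext_one (ModuleCat.of Q Q) hfg hf hg (hM 0))
    (subsingleton_ext_dual hN K (fun j => subsingleton_ext_syzygy _ hfg hf hg j (hM (j + 1))) 0) φ
  obtain ⟨v, rfl⟩ := (Module.bijective_dual_eval Q (Fin n → Q)).2 ψ
  exact ⟨g v, hψ⟩

lemma bijective_dual_eval {N : ℕ}
    (hN : ∀ (M : ModuleCat.{u} Q) [Module.Finite Q M] (i : ℕ), N < i →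
      Subsingleton (Abelian.Ext M (ModuleCat.of Q Q) i))
    (M : Type u) [AddCommGroup M] [Module Q M] [Module.Finite Q M]
    (hM : ∀ i, Subsingleton (Abelian.Ext (ModuleCat.of Q M) (ModuleCat.of Q Q) (i + 1))) :
    Function.Bijective (Module.Dual.eval Q M) := by
  refine ⟨?_, surjective_dual_eval hN M hM⟩
  rw [← LinearMap.ker_eq_bot, eq_bot_iff]
  intro m hm
  obtain ⟨n, K, _, _, _, f, g, hfg, hf, hg⟩ := exists_finite_free_exact (Q := Q) M
  obtain ⟨v, rfl⟩ := hg m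
  have hfs : Function.Surjective f.dualMap :=
    exists_comp_eq_of_subsingleton_ext_one (ModuleCat.of Q Q) hfg hf hg (hM 0)
  obtain ⟨χ, hχ⟩ := (LinearMap.exact_lcomp_of_exact_of_surjective Q
    (LinearMap.exact_lcomp_of_exact_of_surjective Q hfg hg) hfs (Module.Dual.eval Q _ v)).mp
    (LinearMap.ext fun α => LinearMap.congr_fun hm α)
  obtain ⟨κ, rfl⟩ := surjective_dual_eval hN K
    (fun j => subsingleton_ext_syzygy _ hfg hf hg j (hM (j + 1))) χ
  have : f κ = v := (Module.bijective_dual_eval Q (Fin n → Q)).1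
    (LinearMap.ext fun β => LinearMap.congr_fun hχ β)
  rw [← this]
  exact hfg.apply_apply_eq_zero κ

end

end ModuleCat

end Biduality

section Quotients

universe u

variable {A B : Type u} [CommRing A] [CommRing B] (f : A →+* B)

namespace ModuleCat

/-- A ring homomorphism `A →+* B` as a linear map of `A`-modules. -/
def restrictScalarsRingHom : A →ₗ[A] (restrictScalars f).obj (ModuleCat.of B B) where
  toFun a := f a
  map_add' := map_add f
  map_smul' := map_mul f

/-- The unit, as an element of a restriction of scalars. -/
abbrev restrictScalarsOne : (restrictScalars f).obj (ModuleCat.of B B) := (1 : B)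

variable {f}

lemma coextendScalars_smul_apply_one {C : ModuleCat.{u} A} (g : (coextendScalars.{u, u, u} f).obj C)
    (a : A) :
    CoextendScalars.equiv f C (f a • g) (1 : B) = a • CoextendScalars.equiv f C g (1 : B) :=
  (congrArg (CoextendScalars.equiv f C g) (mul_comm 1 (f a))).trans
    (LinearMap.map_smul (CoextendScalars.equiv f C g) a (restrictScalarsOne f))

lemma coextendScalars_apply_map {C : ModuleCat.{u} A} (g : (coextendScalars.{u, u, u} f).obj C)
    (a : A) : CoextendScalars.equiv f C g (f a) = a • CoextendScalars.equiv f C g (1 : B) :=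
  (congrArg (CoextendScalars.equiv f C g) (mul_one (f a)).symm).trans
    (LinearMap.map_smul (CoextendScalars.equiv f C g) a (restrictScalarsOne f))

lemma coextendScalars_ext (hf : Function.Surjective f) {C : ModuleCat.{u} A}
    {g g' : (coextendScalars.{u, u, u} f).obj C}
    (h : CoextendScalars.equiv f C g (1 : B) = CoextendScalars.equiv f C g' (1 : B)) : g = g' := by
  refine CoextendScalars.ext (LinearMap.ext fun b => ?_)
  obtain ⟨a, rfl⟩ := hf b
  exact (coextendScalars_apply_map g a).trans
    ((congrArg (a • ·) h).trans (coextendScalars_apply_map g' a).symm)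

lemma exists_coextendScalars_apply_one_eq (hf : Function.Surjective f) {C : ModuleCat.{u} A} (c : C)
    (hc : ∀ a, f a = 0 → a • c = 0) :
    ∃ g, CoextendScalars.equiv f C g (1 : B) = c := by
  obtain ⟨g, hg⟩ := (LinearMap.exact_lcomp_of_exact_of_surjective C
    (LinearMap.exact_subtype_ker_map (restrictScalarsRingHom f)) hf
    (LinearMap.toSpanSingleton A C c)).mp (LinearMap.ext fun a => hc a a.2)
  refine ⟨(CoextendScalars.equiv f C).symm g, ?_⟩
  have := LinearMap.congr_fun hg 1
  refine Eq.trans ?_ (this.trans (LinearMap.toSpanSingleton_apply_one A C c))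
  exact congrArg g (map_one f).symm

lemma exact_lsmul_restrictScalarsRingHom {Q : Type u} [CommRing Q] (x : Q) :
    Function.Exact (LinearMap.lsmul Q Q x)
      (restrictScalarsRingHom (Ideal.Quotient.mk (Ideal.span {x}))) := by
  intro a
  refine Ideal.Quotient.eq_zero_iff_mem.trans (Ideal.mem_span_singleton'.trans ?_)
  simp [mul_comm x]

lemma exists_smul_eq_of_injective {Q : Type u} [CommRing Q] {x : Q} (hx : IsSMulRegular Q x)
    (I : ModuleCat.{u} Q) [Injective I] (m : I) : ∃ e : I, x • e = m := by
  obtain ⟨ψ, hψ⟩ := exists_comp_eq_of_subsingleton_ext_one I (exact_lsmul_restrictScalarsRingHom x)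
    hx Ideal.Quotient.mk_surjective (subsingleton_of_forall_eq 0 fun x => x.eq_zero_of_injective)
    (LinearMap.toSpanSingleton Q I m)
  refine ⟨ψ 1, ?_⟩
  rw [← map_smul]
  simpa using LinearMap.congr_fun hψ 1

/-- Reduction modulo a nonzerodivisor preserves finite self-injective dimension. -/
lemma subsingleton_ext_quotient_span_singleton {Q : Type u} [CommRing Q] {x : Q}
    (hx : IsSMulRegular Q x) {N : ℕ}
    (hN : ∀ (M : ModuleCat.{u} Q) (i : ℕ), N < i →
      Subsingleton (Abelian.Ext M (ModuleCat.of Q Q) i))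
    (M : ModuleCat.{u} (Q ⧸ Ideal.span {x})) (i : ℕ) (hi : N < i) :
    Subsingleton (Abelian.Ext M
      (ModuleCat.of (Q ⧸ Ideal.span {x}) (Q ⧸ Ideal.span {x})) i) := by
  let B := Q ⧸ Ideal.span {x}
  let f : Q →+* B := Ideal.Quotient.mk (Ideal.span {x})
  have hf : Function.Surjective f := Ideal.Quotient.mk_surjective
  have hfx (a : Q) (ha : f a = 0) : ∃ b, a = x * b :=
    Ideal.mem_span_singleton.mp (Ideal.Quotient.eq_zero_iff_mem.mp ha)
  obtain ⟨S, hS, hS1, hI⟩ := exists_injective_shortExact (ModuleCat.of Q Q)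
  have hI' (j : ℕ) (X : ModuleCat.{u} Q) : Subsingleton (Abelian.Ext X S.X₂ (j + 1)) :=
    subsingleton_of_forall_eq 0 fun x => x.eq_zero_of_injective
  have hK (j : ℕ) (X : ModuleCat.{u} Q)
      (h : Subsingleton (Abelian.Ext X (ModuleCat.of Q Q) (j + 2))) :
      Subsingleton (Abelian.Ext X S.X₃ (j + 1)) :=
    hS.subsingleton_ext_right₃ _ _ (hI' _ _) (hS1 ▸ h)
  have hB (j : ℕ) : Subsingleton (Abelian.Ext ((restrictScalars f).obj (ModuleCat.of B B))
      (ModuleCat.of Q Q) (j + 2)) :=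
    (ModuleCat.shortComplex_shortExact (ModuleCat.shortComplexOfCompEqZero _ _
      (exact_lsmul_restrictScalarsRingHom x).linearMap_comp_eq_zero)
      (exact_lsmul_restrictScalarsRingHom x) hx hf).subsingleton_ext_left₃ _ _
      (subsingleton_ext_succ_of_projective (ModuleCat.of Q Q) _ _)
      (subsingleton_ext_succ_of_projective (ModuleCat.of Q Q) _ _)
  let G := coextendScalars.{u, u, u} f
  obtain ⟨i, rfl⟩ : ∃ j, i = j + 1 := ⟨i - 1, by lia⟩
  have hGK : Subsingleton (Abelian.Ext M (G.obj S.X₃) (i + 1)) :=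
    subsingleton_ext_coextendScalars f S.X₃ (fun j => hK j _ (hB j)) M i (hK i _ (hN _ _ (by lia)))
  have hGI : Subsingleton (Abelian.Ext M (G.obj S.X₂) (i + 2)) :=
    subsingleton_of_forall_eq 0 fun x => x.eq_zero_of_injective
  obtain ⟨ι, g, hι, hιg, hg⟩ : ∃ (ι : Q →ₗ[Q] S.X₂) (g : S.X₂ →ₗ[Q] S.X₃),
      Function.Injective ι ∧ Function.Exact ι g ∧ g = S.g.hom := by
    obtain ⟨s₁, s₂⟩ := S
    obtain rfl : _ = _ := hS1
    exact ⟨_, _, hS.moduleCat_injective_f,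
      (ShortComplex.ShortExact.moduleCat_exact_iff_function_exact _).mp hS.exact, rfl⟩
  have hgs : Function.Surjective g := hg ▸ hS.moduleCat_surjective_g
  obtain ⟨e, he⟩ := exists_smul_eq_of_injective hx S.X₂ (ι 1)
  have he' (q : Q) : ι q = q • x • e := by rw [he, ← map_smul, smul_eq_mul, mul_one]
  obtain ⟨h, hh⟩ := exists_coextendScalars_apply_one_eq (f := f) hf (g e) (fun a ha => by
    obtain ⟨b, rfl⟩ := hfx a ha
    rw [← map_smul, mul_comm, mul_smul, ← he', hιg.apply_apply_eq_zero])
  have hcancel {a b : S.X₂} (hab : g a = g b) (hx' : x • a = x • b) : a = b := by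
    obtain ⟨q, hq⟩ := (hιg (a - b)).mp (by rw [map_sub, hab, sub_self])
    have : q = 0 := hx (hι (by
      simp only [map_smul, hq, smul_sub, hx', sub_self, map_zero, smul_zero]))
    rw [← sub_eq_zero, ← hq, this, map_zero]
  have hkill {C : ModuleCat.{u} Q} (ψ : G.obj C) : x • CoextendScalars.equiv f C ψ (1 : B) = 0 := by
    rw [← coextendScalars_smul_apply_one]
    have : f x = 0 := Ideal.Quotient.eq_zero_iff_mem.mpr (Ideal.mem_span_singleton_self x)
    rw [this, zero_smul]
    rfl
  have hmap (ψ : G.obj S.X₂) : CoextendScalars.equiv f S.X₃ ((G.map S.g).hom ψ) (1 : B) =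
      g (CoextendScalars.equiv f S.X₂ ψ (1 : B)) := by
    rw [hg]
    rfl
  have hinj : Function.Injective (G.map S.g).hom := by
    intro ψ ψ' hψ
    refine coextendScalars_ext hf (hcancel ?_ ((hkill ψ).trans (hkill ψ').symm))
    rw [← hmap, ← hmap, hψ]
  let τ := (LinearMap.range (G.map S.g).hom).mkQ ∘ₗ LinearMap.toSpanSingleton B _ h
  have hτ : Function.Bijective τ := by
    constructor
    · rw [← LinearMap.ker_eq_bot, eq_bot_iff]
      intro b hb
      obtain ⟨q, rfl⟩ := hf b
      obtain ⟨ψ, hψ⟩ : f q • h ∈ LinearMap.range (G.map S.g).hom :=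
        (Submodule.Quotient.mk_eq_zero _).mp hb
      have h1 : g (CoextendScalars.equiv f S.X₂ ψ (1 : B)) = g (q • e) := by
        rw [← hmap, hψ, coextendScalars_smul_apply_one, hh, map_smul]
      obtain ⟨q', hq'⟩ := (hιg (q • e - CoextendScalars.equiv f S.X₂ ψ (1 : B))).mp
        (by rw [map_sub, h1, sub_self])
      have h2 : x * q' = q := hι (by
        rw [← smul_eq_mul, map_smul, hq', smul_sub, hkill, sub_zero, he', smul_comm])
      exact (Submodule.mem_bot _).mpr (Ideal.Quotient.eq_zero_iff_mem.mpr
        (Ideal.mem_span_singleton'.mpr ⟨q', (mul_comm _ _).trans h2⟩))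
    · intro y
      obtain ⟨φ, rfl⟩ := Submodule.mkQ_surjective _ y
      obtain ⟨m, hm⟩ := hgs (CoextendScalars.equiv f S.X₃ φ (1 : B))
      obtain ⟨q, hq⟩ := (hιg (x • m)).mp (by rw [map_smul, hm, hkill])
      obtain ⟨ψ, hψ⟩ := exists_coextendScalars_apply_one_eq (f := f) hf (q • e - m) (fun a ha => by
        obtain ⟨b, rfl⟩ := hfx a ha
        rw [mul_comm, mul_smul, smul_sub, smul_comm x q e, ← he', hq, sub_self, smul_zero])
      refine ⟨f q, (Submodule.Quotient.eq _).mpr ⟨ψ, coextendScalars_ext hf ?_⟩⟩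
      rw [hmap, hψ, map_sub, map_smul, hm, map_sub]
      refine Eq.trans ?_ (congrArg (· - CoextendScalars.equiv f S.X₃ φ (1 : B))
        (coextendScalars_smul_apply_one h q)).symm
      simp only [hh]
  have hS' := ModuleCat.shortComplex_shortExact (ModuleCat.shortComplexOfCompEqZero _ _
      (LinearMap.range_mkQ_comp (G.map S.g).hom))
      (LinearMap.exact_map_mkQ_range _) hinj (Submodule.mkQ_surjective _)
  exact (extEquivOfIsoRight M (LinearEquiv.ofBijective τ hτ).toModuleIso _).subsingleton_congr.mpr
    (hS'.subsingleton_ext_right₃ _ _ hGK hGI)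

end ModuleCat

end Quotients

section Canonical

open IsLocalRing

universe u

variable {Q R : Type u} [CommRing Q] [CommRing R] {f : Q →+* R}

namespace ModuleCat

lemma finite_dual [IsNoetherianRing Q] (M : Type u) [AddCommGroup M] [Module Q M]
    [Module.Finite Q M] : Module.Finite Q (Module.Dual Q M) :=
  inferInstance

lemma subsingleton_ext_dual_obj [IsNoetherianRing Q] {N : ℕ}
    (hN : ∀ (M : ModuleCat.{u} Q) [Module.Finite Q M] (i : ℕ), N < i →
      Subsingleton (Abelian.Ext M (ModuleCat.of Q Q) i)) (M : ModuleCat.{u} Q) [Module.Finite Q M]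
    (hM : ∀ i, Subsingleton (Abelian.Ext M (ModuleCat.of Q Q) (i + 1))) (i : ℕ) :
    Subsingleton (Abelian.Ext (ModuleCat.of Q (Module.Dual Q M)) (ModuleCat.of Q Q) (i + 1)) :=
  subsingleton_ext_dual hN M hM i

variable (f) in
/-- The coextension of `Q` along `Q →+* R`, as a `Q`-module, is the dual of `R`. -/
noncomputable def restrictScalarsCoextendScalarsEquiv :
    (restrictScalars f).obj ((coextendScalars.{u, u, u} f).obj (ModuleCat.of Q Q)) ≃ₗ[Q]
      Module.Dual Q ((restrictScalars f).obj (ModuleCat.of R R)) where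
  toFun g := CoextendScalars.equiv f (ModuleCat.of Q Q) g
  invFun g := (CoextendScalars.equiv f (ModuleCat.of Q Q)).symm g
  map_add' _ _ := rfl
  map_smul' q g := LinearMap.ext fun (s : R) => by
    let g' : (coextendScalars.{u, u, u} f).obj (ModuleCat.of Q Q) := g
    refine (congrArg (CoextendScalars.equiv f (ModuleCat.of Q Q) g') (mul_comm s (f q))).trans ?_
    exact LinearMap.map_smul (CoextendScalars.equiv f (ModuleCat.of Q Q) g') q s
  left_inv _ := rfl
  right_inv _ := rfl

lemma finite_restrictScalars (hf : Function.Surjective f) (M : ModuleCat.{u} R)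
    [Module.Finite R M] : Module.Finite Q ((restrictScalars f).obj M) := by
  obtain ⟨s, hs⟩ := Module.Finite.fg_top (R := R) (M := M)
  refine ⟨⟨s, eq_top_iff.mpr fun (m : M) _ => ?_⟩⟩
  have hm : m ∈ Submodule.span R (s : Set M) := hs ▸ Submodule.mem_top
  induction hm using Submodule.span_induction with
  | mem x hx => exact Submodule.subset_span hx
  | zero => exact Submodule.zero_mem _
  | add x y _ _ hx hy => exact Submodule.add_mem _ (hx trivial) (hy trivial)
  | smul a x _ hx =>
    obtain ⟨q, rfl⟩ := hf a
    exact Submodule.smul_mem _ q (hx trivial)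

lemma finite_of_finite_restrictScalars (M : ModuleCat.{u} R)
    [h : Module.Finite Q ((restrictScalars f).obj M)] : Module.Finite R M := by
  obtain ⟨s, hs⟩ := h.fg_top
  refine ⟨⟨s, eq_top_iff.mpr fun (m : (restrictScalars f).obj M) _ => ?_⟩⟩
  have hm : m ∈ Submodule.span Q (s : Set ((restrictScalars f).obj M)) :=
    hs ▸ Submodule.mem_top
  induction hm using Submodule.span_induction with
  | mem x hx => exact Submodule.subset_span hx
  | zero => exact Submodule.zero_mem _
  | add x y _ _ hx hy => exact Submodule.add_mem _ (hx trivial) (hy trivial)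
  | smul a x _ hx => exact Submodule.smul_mem _ (f a) (hx trivial)

lemma bijective_lsmul_coextendScalars (hf : Function.Surjective f)
    (h : Function.Bijective
      (Module.Dual.eval Q ((restrictScalars f).obj (ModuleCat.of R R)))) :
    Function.Bijective
      (LinearMap.lsmul R ((coextendScalars.{u, u, u} f).obj (ModuleCat.of Q Q))) := by
  have hsmul (r : R) (c : (coextendScalars.{u, u, u} f).obj (ModuleCat.of Q Q)) :
      CoextendScalars.equiv f _ (r • c) (1 : R) = CoextendScalars.equiv f _ c r :=
    congrArg (CoextendScalars.equiv f _ c) (one_mul r)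
  constructor
  · rw [← LinearMap.ker_eq_bot, eq_bot_iff]
    intro r hr
    refine h.1 (a₂ := 0) (LinearMap.ext fun g => ?_)
    let c := (CoextendScalars.equiv f (ModuleCat.of Q Q)).symm g
    have hc : r • c = 0 := LinearMap.congr_fun hr c
    refine (hsmul r c).symm.trans ?_
    rw [hc, map_zero]
    exact (map_zero g).symm
  · intro ψ
    let ev : Module.Dual Q ((restrictScalars f).obj (ModuleCat.of R R)) →ₗ[Q] Q :=
      LinearMap.applyₗ (restrictScalarsOne f) ∘ₗ
        (restrictScalarsCoextendScalarsEquiv f).toLinearMap ∘ₗ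
        ((restrictScalars f).map (ModuleCat.ofHom ψ)).hom ∘ₗ
        (restrictScalarsCoextendScalarsEquiv f).symm.toLinearMap
    obtain ⟨r, hr⟩ := h.2 ev
    exact ⟨r, LinearMap.ext fun c => coextendScalars_ext hf
      ((hsmul r c).trans (LinearMap.congr_fun hr (CoextendScalars.equiv f _ c)))⟩

/-- If `Q` has finite self-injective dimension and `Ext_Q^i(R, Q) = 0` for `i ≥ 1`, then
`Hom_Q(R, Q)` is dualizing for the quotient `R` of `Q`. -/
lemma exists_dualizing_of_subsingleton_ext [IsNoetherianRing Q] (hf : Function.Surjective f) {N : ℕ}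
    (hN : ∀ (M : ModuleCat.{u} Q) (i : ℕ), N < i →
      Subsingleton (Abelian.Ext M (ModuleCat.of Q Q) i))
    (hR : ∀ i, Subsingleton (Abelian.Ext ((restrictScalars f).obj (ModuleCat.of R R))
      (ModuleCat.of Q Q) (i + 1))) :
    ∃ C : ModuleCat.{u} R, Module.Finite R C ∧ Function.Bijective (LinearMap.lsmul R C) ∧
      (∀ i, Subsingleton (Abelian.Ext C C (i + 1))) ∧
      ∀ (M : ModuleCat.{u} R) (i : ℕ), N < i → Subsingleton (Abelian.Ext M C i) := by
  have := finite_restrictScalars hf (ModuleCat.of R R)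
  let e := restrictScalarsCoextendScalarsEquiv f
  have := finite_dual (Q := Q) ((restrictScalars f).obj (ModuleCat.of R R))
  have : Module.Finite Q ((restrictScalars f).obj
    ((coextendScalars.{u, u, u} f).obj (ModuleCat.of Q Q))) := Module.Finite.equiv e.symm
  refine ⟨(coextendScalars.{u, u, u} f).obj (ModuleCat.of Q Q),
    finite_of_finite_restrictScalars (f := f) _, bijective_lsmul_coextendScalars hf
      (bijective_dual_eval (fun M _ i hi => hN M i hi) _ hR), fun i => ?_, fun M i hi => ?_⟩
  · have hD := subsingleton_ext_dual_obj (fun M _ i hi => hN M i hi)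
      ((restrictScalars f).obj (ModuleCat.of R R)) hR i
    exact subsingleton_ext_coextendScalars f (ModuleCat.of Q Q) hR _ i
      ((extLinearEquivOfIso e.toModuleIso _ _).symm.toEquiv.subsingleton_congr.mpr
        hD)
  · obtain ⟨i, rfl⟩ : ∃ j, i = j + 1 := ⟨i - 1, by lia⟩
    exact subsingleton_ext_coextendScalars f (ModuleCat.of Q Q) hR M i (hN _ _ hi)

end ModuleCat

end Canonical

section MaximalCohenMacaulay

open IsLocalRing Pointwise

universe u

variable {Q R : Type u} [CommRing Q] [CommRing R] {f : Q →+* R}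

namespace ModuleCat

lemma exists_linearEquiv_quotSMulTop_restrictScalars (M : ModuleCat.{u} R) (y : Q) :
    Nonempty (QuotSMulTop y ((restrictScalars f).obj M) ≃ₗ[Q]
      (restrictScalars f).obj (ModuleCat.of R (QuotSMulTop (f y) M))) := by
  let π := ((restrictScalars f).map (ModuleCat.ofHom
    (Submodule.mkQ (f y • (⊤ : Submodule R M))))).hom
  have hπ : Function.Surjective π := Submodule.mkQ_surjective (f y • (⊤ : Submodule R M))
  refine ⟨(Submodule.quotEquivOfEq _ _ ?_).trans (π.quotKerEquivOfSurjective hπ)⟩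
  refine Submodule.ext fun (m : M) => ?_
  refine (Submodule.mem_smul_pointwise_iff_exists _ _ _).trans (Iff.trans ?_
    ((Submodule.Quotient.mk_eq_zero (M := M) (f y • (⊤ : Submodule R M)) (x := m)).trans
    (Submodule.mem_smul_pointwise_iff_exists _ _ _)).symm)
  rfl

lemma subsingleton_ext_restrictScalars_of_depth [IsNoetherianRing Q] [IsLocalRing Q] [IsLocalRing R]
    (hf : Function.Surjective f) {n : ℕ}
    (C : ModuleCat.{u} Q) [Module.Finite Q C]
    (hn : ∀ (M : ModuleCat.{u} Q) [Module.Finite Q M] (i : ℕ), n < i →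
      Subsingleton (Abelian.Ext M C i)) (d : ℕ) (M : ModuleCat.{u} R) [Module.Finite R M]
    (hM : ∀ i < d, Subsingleton (Abelian.Ext (ModuleCat.of R (R ⧸ maximalIdeal R)) M i)) (j : ℕ)
    (hj : n < j + d) : Subsingleton (Abelian.Ext ((restrictScalars f).obj M) C j) := by
  have : IsNoetherianRing R := isNoetherianRing_of_surjective Q R f hf
  induction d generalizing M j with
  | zero =>
    have := finite_restrictScalars hf M
    exact hn _ _ hj
  | succ d ih =>
    obtain ⟨x, hx, hxM⟩ := exists_isSMulRegular_of_subsingleton_ext_zero M (hM 0 (by lia))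
    obtain ⟨y, rfl⟩ := hf x
    have hy : y ∈ maximalIdeal Q := fun h => hx (h.map f)
    have := finite_restrictScalars hf M
    have hS := hxM.smulShortComplex_shortExact
    have hq := ih (ModuleCat.of R (QuotSMulTop (f y) M)) (fun i hi =>
      hS.subsingleton_ext_right₃ _ i (hM i (by lia)) (hM (i + 1) (by lia))) (j + 1) (by lia)
    by_contra hsub
    have hyM : IsSMulRegular ((restrictScalars f).obj M) y := hxM
    have h1 := mem_support_ext_quotSMulTop C _ j _ hyM hy (closedPoint_mem_support_ext _ C j hsub)
    obtain ⟨e⟩ := exists_linearEquiv_quotSMulTop_restrictScalars (f := f) M y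
    have h2 : Subsingleton (Abelian.Ext (ModuleCat.of Q
        (QuotSMulTop y ((restrictScalars f).obj M))) C (j + 1)) :=
      (extLinearEquivOfIso e.toModuleIso C (j + 1)).symm.toEquiv.subsingleton_congr.mpr hq
    rw [Module.support_eq_empty_iff.mpr h2] at h1
    exact h1

lemma exists_ltSeries_of_not_subsingleton_ext_zero [IsNoetherianRing Q] [IsLocalRing Q]
    (M : ModuleCat.{u} Q) [Module.Finite Q M]
    (h0 : ¬ Subsingleton (Abelian.Ext M (ModuleCat.of Q Q) 0)) :
    ∃ s : LTSeries (PrimeSpectrum Q), s.head ∈ Module.support Q M ∧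
      ¬ Subsingleton (Abelian.Ext (ModuleCat.of Q (Q ⧸ maximalIdeal Q))
        (ModuleCat.of Q Q) s.length) := by
  obtain ⟨p, hp, hpq⟩ := exists_prime_mem_support_ext (ModuleCat.of Q Q) (closedPoint Q) 0
    M (closedPoint_mem_support_ext M _ _ h0)
  obtain ⟨s, rfl, -, hs⟩ := exists_ltSeries_mem_support_ext (ModuleCat.of Q Q) _ _ _ hpq
  refine ⟨s, hp, fun h => ?_⟩
  rw [zero_add] at hs
  have hnt := Module.nonempty_support_iff.mp ⟨_, hs⟩
  exact not_nontrivial_iff_subsingleton.mpr h hnt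

lemma length_le_ringKrullDim_of_head_mem_support (hf : Function.Surjective f)
    (s : LTSeries (PrimeSpectrum Q))
    (hs : s.head ∈ Module.support Q ((restrictScalars f).obj (ModuleCat.of R R))) :
    (s.length : WithBot ℕ∞) ≤ ringKrullDim R := by
  have := finite_restrictScalars hf (ModuleCat.of R R)
  have hker : RingHom.ker f ≤ s.head.asIdeal := by
    refine le_trans ?_ (Module.mem_support_iff_of_finite.mp hs)
    intro q hq
    refine Module.mem_annihilator.mpr fun (r : R) => ?_
    change f q * r = 0
    rw [RingHom.mem_ker.mp hq, zero_mul]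
  rw [← ringKrullDim_eq_of_ringEquiv (RingHom.quotientKerEquivOfSurjective hf),
    ringKrullDim_quotient]
  exact Order.LTSeries.length_le_krullDim (⟨s.length, fun i => ⟨s i, fun x hx =>
    (show s.head ≤ s i from s.head_le i) (hker hx)⟩, fun i => s.step i⟩ :
    LTSeries (PrimeSpectrum.zeroLocus (RingHom.ker f : Set Q)))

/-- A Cohen–Macaulay quotient `R` of a Gorenstein local ring `Q` of the same dimension satisfies
`Ext_Q^i(R, Q) = 0` for `i ≥ 1`. -/
lemma subsingleton_ext_of_not_subsingleton_ext_zero [IsNoetherianRing Q] [IsLocalRing Q]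
    [IsLocalRing R] (hf : Function.Surjective f) {N : ℕ}
    (hN : ∀ (M : ModuleCat.{u} Q) (i : ℕ), N < i →
      Subsingleton (Abelian.Ext M (ModuleCat.of Q Q) i))
    {d : ℕ} (hd : ringKrullDim R = d)
    (hR : ∀ i < d, Subsingleton (Abelian.Ext (ModuleCat.of R (R ⧸ maximalIdeal R))
      (ModuleCat.of R R) i))
    (h0 : ¬ Subsingleton (Abelian.Ext ((restrictScalars f).obj (ModuleCat.of R R))
      (ModuleCat.of Q Q) 0)) (i : ℕ) :
    Subsingleton (Abelian.Ext ((restrictScalars f).obj (ModuleCat.of R R))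
      (ModuleCat.of Q Q) (i + 1)) := by
  classical
  have := finite_restrictScalars hf (ModuleCat.of R R)
  obtain ⟨s, hs, hs'⟩ := exists_ltSeries_of_not_subsingleton_ext_zero _ h0
  have hsd : s.length ≤ d := by
    exact_mod_cast (length_le_ringKrullDim_of_head_mem_support hf s hs).trans_eq hd
  have hex : ∃ n, ¬ Subsingleton (Abelian.Ext (ModuleCat.of Q (Q ⧸ maximalIdeal Q))
      (ModuleCat.of Q Q) n) := ⟨_, hs'⟩
  have hle : Nat.find hex ≤ s.length := Nat.find_min' hex hs'
  exact subsingleton_ext_restrictScalars_of_depth hf (ModuleCat.of Q Q)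
    (fun M _ i hi => subsingleton_ext_of_depth (ModuleCat.of Q Q) (fun M _ i hi => hN M i hi)
      (fun i hi => not_not.mp (Nat.find_min hex hi)) (Nat.find_spec hex) M i hi)
    d (ModuleCat.of R R) hR (i + 1) (by lia)

lemma exists_isSMulRegular_of_subsingleton_ext [IsNoetherianRing Q] (hf : Function.Surjective f)
    (h0 : Subsingleton (Abelian.Ext ((restrictScalars f).obj (ModuleCat.of R R))
      (ModuleCat.of Q Q) 0)) : ∃ x, f x = 0 ∧ IsSMulRegular Q x := by
  have := finite_restrictScalars hf (ModuleCat.of R R)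
  have : Subsingleton ((restrictScalars f).obj (ModuleCat.of R R) →ₗ[Q] Q) :=
    (Abelian.Ext.addEquiv₀.trans (ModuleCat.homAddEquiv
      (M := (restrictScalars f).obj (ModuleCat.of R R)) (N := ModuleCat.of Q Q))
      ).symm.toEquiv.subsingleton
  obtain ⟨x, hx, hxQ⟩ := IsSMulRegular.subsingleton_linearMap_iff.mp this
  exact ⟨x, (mul_one (f x)).symm.trans (Module.mem_annihilator.mp hx (restrictScalarsOne f)), hxQ⟩

lemma exists_dualizing_of_surjective {R : Type u} [CommRing R] [IsLocalRing R] {d : ℕ}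
    (hd : ringKrullDim R = d)
    (hR : ∀ i < d, Subsingleton (Abelian.Ext (ModuleCat.of R (R ⧸ maximalIdeal R))
      (ModuleCat.of R R) i)) {N : ℕ} (m : ℕ)
    (Q : Type u) [CommRing Q] [IsNoetherianRing Q] [IsLocalRing Q] (hQ : ringKrullDim Q < m)
    (hN : ∀ (M : ModuleCat.{u} Q) (i : ℕ), N < i →
      Subsingleton (Abelian.Ext M (ModuleCat.of Q Q) i))
    (f : Q →+* R) (hf : Function.Surjective f) :
    ∃ C : ModuleCat.{u} R, Module.Finite R C ∧ Function.Bijective (LinearMap.lsmul R C) ∧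
      (∀ i, Subsingleton (Abelian.Ext C C (i + 1))) ∧
      ∀ (M : ModuleCat.{u} R) (i : ℕ), N < i → Subsingleton (Abelian.Ext M C i) := by
  induction m generalizing Q with
  | zero => exact absurd hQ (not_lt.mpr (ringKrullDim_nonneg_of_nontrivial))
  | succ m ih =>
    by_cases h0 : Subsingleton (Abelian.Ext ((restrictScalars f).obj (ModuleCat.of R R))
      (ModuleCat.of Q Q) 0)
    · obtain ⟨x, hx, hxQ⟩ := exists_isSMulRegular_of_subsingleton_ext hf h0
      have hI (a : Q) (ha : a ∈ Ideal.span {x}) : f a = 0 := by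
        obtain ⟨b, rfl⟩ := Ideal.mem_span_singleton.mp ha
        rw [map_mul, hx, zero_mul]
      let g : Q ⧸ Ideal.span {x} →+* R := Ideal.Quotient.lift _ f hI
      have hg : Function.Surjective g := Ideal.Quotient.lift_surjective_of_surjective _ hI hf
      have : Nontrivial (Q ⧸ Ideal.span {x}) := g.domain_nontrivial
      have : IsLocalRing (Q ⧸ Ideal.span {x}) :=
        IsLocalRing.of_surjective' _ Ideal.Quotient.mk_surjective
      refine ih (Q ⧸ Ideal.span {x}) ?_ (subsingleton_ext_quotient_span_singleton hxQ hN) g hg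
      have hdim := ringKrullDim_quotient_succ_le_of_nonZeroDivisor (R := Q) (r := x)
        (mem_nonZeroDivisors_iff.mpr ⟨fun y hy => hxQ (hy.trans (mul_zero x).symm),
          fun y hy => hxQ ((mul_comm x y).trans (hy.trans (mul_zero x).symm))⟩)
      by_contra! hm
      refine absurd (hdim.trans_lt hQ) (not_lt.mpr ?_)
      push_cast
      gcongr
    · exact exists_dualizing_of_subsingleton_ext hf hN
        (subsingleton_ext_of_not_subsingleton_ext_zero hf hN hd hR h0)

end ModuleCat

end MaximalCohenMacaulay

section Main

open IsLocalRing

variable {R : Type} [CommRing R]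

/-- A ring with a dualizing module is a quotient of a Gorenstein ring, the trivial extension. -/
lemma exists_isGorenstein_of_dualizing [IsNoetherianRing R] [IsLocalRing R]
    (C : Type) [AddCommGroup C] [Module R C]
    (hC : IsSemidualizing R C) (hC' : HasFiniteInjectiveDimension R (ModuleCat.of R C)) :
    ∃ (Q : Type) (_ : CommRing Q) (_ : IsNoetherianRing Q) (_ : IsLocalRing Q),
      IsGorenstein Q ∧ ∃ f : Q →+* R, Function.Surjective f := by
  let _ : Module Rᵐᵒᵖ C := Module.compHom C ((RingHom.id R).fromOpposite mul_comm)
  have : IsCentralScalar R C := ⟨fun _ _ => rfl⟩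
  obtain ⟨hfin, hl, hCC⟩ := hC
  obtain ⟨N, hN⟩ := hC'
  refine ⟨TrivSqZeroExt R C, inferInstance, TrivSqZeroExt.isNoetherianRing C,
    TrivSqZeroExt.isLocalRing C, ⟨N, fun M i hi => ?_⟩,
    (TrivSqZeroExt.fstHom R R C).toRingHom, TrivSqZeroExt.fst_surjective⟩
  rw [subsingleton_extMod_iff]
  exact TrivSqZeroExt.subsingleton_ext_self C hl
    (fun i => (subsingleton_extMod_iff _ _ _).mp (hCC (i + 1) (by lia)))
    (fun M i hi => (subsingleton_extMod_iff _ _ _).mp (hN M i hi)) M i hi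

lemma isCohenMacaulayLocal_of_dualizing [IsNoetherianRing R] [IsLocalRing R]
    (C : Type) [AddCommGroup C] [Module R C]
    (hC : IsSemidualizing R C) (hC' : HasFiniteInjectiveDimension R (ModuleCat.of R C)) :
    IsCohenMacaulayLocal R := by
  obtain ⟨hfin, hl, -⟩ := hC
  obtain ⟨N, hN⟩ := hC'
  have hann : Module.annihilator R C = ⊥ := by
    refine eq_bot_iff.mpr fun r hr => hl.1 (LinearMap.ext fun c => ?_)
    simpa using Module.mem_annihilator.mp hr c
  obtain ⟨d, hd, h⟩ := ModuleCat.exists_ringKrullDim_eq_of_finite_injectiveDimension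
    (ModuleCat.of R C) hann (N := N) fun M _ i hi => (subsingleton_extMod_iff _ _ _).mp (hN M i hi)
  exact ⟨d, hd, fun i hi => (subsingleton_extMod_iff _ _ _).mpr (h i hi)⟩

lemma exists_dualizing_of_isGorenstein [IsLocalRing R] (hR : IsCohenMacaulayLocal R)
    {Q : Type} [CommRing Q] [IsNoetherianRing Q] [IsLocalRing Q] (hQ : IsGorenstein Q)
    (f : Q →+* R) (hf : Function.Surjective f) :
    ∃ C : ModuleCat R, IsSemidualizing R C ∧ HasFiniteInjectiveDimension R C := by
  obtain ⟨d, hd, hR⟩ := hR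
  obtain ⟨N, hN⟩ := hQ
  obtain ⟨m, hm⟩ : ∃ m : ℕ, ringKrullDim Q < m := by
    obtain ⟨n, hn⟩ : ∃ n : ℕ, ringKrullDim Q = n :=
      ⟨_, Order.krullDim_eq_length_of_finiteDimensionalOrder⟩
    exact ⟨n + 1, hn ▸ by exact_mod_cast n.lt_succ_self⟩
  obtain ⟨C, h1, h2, h3, h4⟩ := ModuleCat.exists_dualizing_of_surjective hd
    (fun i hi => (subsingleton_extMod_iff _ _ _).mp (hR i hi)) m Q hm
    (fun M i hi => (subsingleton_extMod_iff _ _ _).mp (hN M i hi)) f hf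
  refine ⟨C, ⟨h1, h2, fun i hi => ?_⟩, N, fun M i hi => (subsingleton_extMod_iff _ _ _).mpr
    (h4 M i hi)⟩
  obtain ⟨i, rfl⟩ : ∃ j, i = j + 1 := ⟨i - 1, by lia⟩
  exact (subsingleton_extMod_iff _ _ _).mpr (h3 i)

end Main

/-- A noetherian local ring has a dualizing module (a semidualizing module of finite
injective dimension) iff it is Cohen–Macaulay and a homomorphic image of a Gorenstein
local ring. -/
theorem exists_dualizing_module_iff
    (R : Type) [CommRing R] [IsNoetherianRing R] [IsLocalRing R] :
    (∃ C : ModuleCat R, IsSemidualizing R C ∧ HasFiniteInjectiveDimension R C) ↔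
      (IsCohenMacaulayLocal R ∧
        ∃ (Q : Type) (_ : CommRing Q) (_ : IsNoetherianRing Q) (_ : IsLocalRing Q),
          IsGorenstein Q ∧ ∃ f : Q →+* R, Function.Surjective f) := by
  constructor
  · rintro ⟨C, hC, hC'⟩
    exact ⟨isCohenMacaulayLocal_of_dualizing C hC hC', exists_isGorenstein_of_dualizing C hC hC'⟩
  · rintro ⟨hR, Q, _, _, _, hQ, f, hf⟩
    exact exists_dualizing_of_isGorenstein hR hQ f hf
end
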